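/- arXiv:1312.0065 — 5 statements merged into one kernel-verified Lean document; each statement's English description precedes it below -/
import Mathlib

section
/- For a random walk on a connected graph G, the hitting time is given by H(x,y) = (1/τ(G)) · Σ_{u ∈ V(G)} d_u · Σ_{P ∈ P_G(x,u), y ∉ P} τ(G/{P,y}), where the inner sum is over simple paths P from x to u not containing y, and G/{P,y} is the multigraph obtained from G by contracting the vertex set of P together with y to a single vertex. -/
/-- `H` is the vector of expected hitting times of the simple random walk on `G`. -/
def IsHittingTime {V : Type*} [Fintype V] (G : SimpleGraph V) [DecidableRel G.Adj]
    (H : V → V → ℝ) : Prop :=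
  (∀ y, H y y = 0) ∧
  ∀ x y, x ≠ y → H x y = 1 + (∑ z ∈ G.neighborFinset x, H z y) / (G.degree x)

/-- The number of spanning trees of a finite simple graph. -/
noncomputable def spanningTreeCount {V : Type*} [Fintype V] (G : SimpleGraph V) : ℕ :=
  Nat.card {T : SimpleGraph V // T ≤ G ∧ T.Connected ∧ T.IsAcyclic}

/-- The number of spanning trees of the multigraph `G/S` obtained from `G` by
contracting the vertex set `S` to a single vertex (keeping multi-edges, deleting loops).
Spanning trees of `G/S` correspond bijectively to spanning forests `F` of `G`
that do not connect two distinct vertices of `S` and each of whose components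
meets `S`. -/
noncomputable def contractedTreeCount {V : Type*} [Fintype V] (G : SimpleGraph V)
    (S : Set V) : ℕ :=
  Nat.card {F : SimpleGraph V // F ≤ G ∧ F.IsAcyclic ∧
    (∀ u ∈ S, ∀ v ∈ S, u ≠ v → ¬F.Reachable u v) ∧
    (∀ w : V, ∃ u ∈ S, F.Reachable w u)}

/-- Parent functions of forests rooted at `S`. -/
def IsPar {V : Type*} (G : SimpleGraph V) (S : Set V) (f : V → V) : Prop :=
  (∀ s ∈ S, f s = s) ∧ (∀ v, v ∉ S → G.Adj v (f v)) ∧ ∀ v, ∃ n : ℕ, f^[n] v ∈ S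

/-- `u` lies on the forward orbit of `x`. -/
def Hits {V : Type*} (f : V → V) (x u : V) : Prop := ∃ n : ℕ, f^[n] x = u

set_option linter.unusedSectionVars false

namespace HT
variable {V : Type*}

lemma hits_refl (f : V → V) (x : V) : Hits f x x := ⟨0, rfl⟩

lemma hits_trans {f : V → V} {x y z : V} (h : Hits f x y) (h' : Hits f y z) : Hits f x z := by
  obtain ⟨n, rfl⟩ := h
  obtain ⟨m, rfl⟩ := h'
  exact ⟨m + n, Function.iterate_add_apply f m n x⟩

lemma hits_step (f : V → V) (x : V) : Hits f x (f x) := ⟨1, rfl⟩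

lemma hits_of_ne {f : V → V} {x u : V} (h : Hits f x u) (hne : x ≠ u) : Hits f (f x) u := by
  obtain ⟨n, hn⟩ := h
  cases n with
  | zero => exact absurd hn hne
  | succ n => exact ⟨n, by rwa [Function.iterate_succ_apply] at hn⟩

lemma iter_fix {f : V → V} {s : V} (h : f s = s) (n : ℕ) : f^[n] s = s :=
  Function.iterate_fixed h n

lemma root_unique {f : V → V} {x s t : V} (hs : f s = s) (ht : f t = t)
    (h1 : Hits f x s) (h2 : Hits f x t) : s = t := by
  obtain ⟨n, hn⟩ := h1
  obtain ⟨m, hm⟩ := h2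
  have e1 : f^[m + n] x = s := by rw [Function.iterate_add_apply, hn, iter_fix hs]
  have e2 : f^[n + m] x = t := by rw [Function.iterate_add_apply, hm, iter_fix ht]
  rw [← e1, ← e2, add_comm]

lemma not_periodic {G : SimpleGraph V} {S : Set V} {f : V → V} (hf : IsPar G S f) {x : V}
    (hx : x ∉ S) : ¬ Hits f (f x) x := by
  rintro ⟨n, hn⟩
  obtain ⟨m, hm⟩ := hf.2.2 x
  have hp : f^[n+1] x = x := hn
  have h2 : (f^[n+1])^[m] x = x := Function.iterate_fixed hp m
  rw [← Function.iterate_mul] at h2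
  have h3 : (n+1)*m = n*m + m := by ring
  rw [h3, Function.iterate_add_apply, iter_fix (hf.1 _ hm)] at h2
  exact hx (h2 ▸ hm)

variable [DecidableEq V]

lemma iter_update {f : V → V} {v w z : V} (h : ¬ Hits f w v) (n : ℕ) :
    (Function.update f v z)^[n] w = f^[n] w := by
  induction n with
  | zero => rfl
  | succ n ih =>
    rw [Function.iterate_succ_apply', Function.iterate_succ_apply', ih,
      Function.update_of_ne]
    exact fun e => h ⟨n, e⟩

lemma hits_update_iff {f : V → V} {v w z t : V} (h : ¬ Hits f w v) :
    Hits (Function.update f v z) w t ↔ Hits f w t := by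
  simp only [Hits, iter_update h]

lemma hits_update_self {f : V → V} {v w : V} (z : V) (h : Hits f w v) :
    Hits (Function.update f v z) w v := by
  obtain ⟨n, hn⟩ := h
  induction n generalizing w with
  | zero => exact ⟨0, hn⟩
  | succ n ih =>
    by_cases hw : w = v
    · subst hw; exact hits_refl _ _
    · have := ih (w := f w) hn
      refine hits_trans ?_ this
      have h2 := hits_step (Function.update f v z) w
      rwa [Function.update_of_ne hw] at h2

lemma par_hits {G : SimpleGraph V} {S : Set V} {f : V → V} (hf : IsPar G S f) (v : V) :
    ∃ s ∈ S, Hits f v s := by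
  obtain ⟨n, hn⟩ := hf.2.2 v
  exact ⟨_, hn, n, rfl⟩

lemma par_cut {G : SimpleGraph V} {S : Set V} {f : V → V} (hf : IsPar G S f) {x : V}
    (hx : x ∉ S) : IsPar G (insert x S) (Function.update f x x) := by
  refine ⟨?_, ?_, ?_⟩
  · intro s hs
    by_cases h : s = x
    · subst h; simp
    · rw [Function.update_of_ne h]
      exact hf.1 s (hs.resolve_left h)
  · intro v hv
    have h : v ≠ x := fun e => hv (Or.inl e)
    rw [Function.update_of_ne h]
    exact hf.2.1 v (fun h' => hv (Or.inr h'))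
  · intro v
    by_cases h : Hits f v x
    · obtain ⟨n, hn⟩ := hits_update_self x h
      exact ⟨n, Or.inl hn⟩
    · obtain ⟨n, hn⟩ := hf.2.2 v
      exact ⟨n, by rw [iter_update h]; exact Or.inr hn⟩

lemma hits_link {x : V} {G : SimpleGraph V} {S : Set V} {f : V → V} (hf : IsPar G (insert x S) f)
    (hx : x ∉ S) {z t : V} (ht : t ∈ S) (hz : Hits f z t) :
    Hits (Function.update f x z) x t ∧ Hits (Function.update f x z) z t := by
  have hzx : ¬ Hits f z x := fun h =>
    hx ((root_unique (hf.1 x (Or.inl rfl)) (hf.1 t (Or.inr ht)) h hz) ▸ ht)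
  have h1 := (hits_update_iff (z := z) (t := t) hzx).2 hz
  refine ⟨hits_trans ?_ h1, h1⟩
  have := hits_step (Function.update f x z) x
  simpa using this

lemma par_link {G : SimpleGraph V} {S : Set V} {f : V → V} {x : V}
    (hf : IsPar G (insert x S) f)
    (hx : x ∉ S) {z t : V} (hadj : G.Adj x z) (ht : t ∈ S) (hz : Hits f z t) :
    IsPar G S (Function.update f x z) := by
  refine ⟨?_, ?_, ?_⟩
  · intro s hs
    have h : s ≠ x := fun e => hx (e ▸ hs)
    rw [Function.update_of_ne h]
    exact hf.1 s (Or.inr hs)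
  · intro v hv
    by_cases h : v = x
    · subst h; simpa using hadj
    · rw [Function.update_of_ne h]
      exact hf.2.1 v (fun h' => h'.elim h hv)
  · intro v
    by_cases h : Hits f v x
    · obtain ⟨n, hn⟩ := hits_trans (hits_update_self z h) (hits_link hf hx ht hz).1
      exact ⟨n, hn ▸ ht⟩
    · obtain ⟨n, hn⟩ := hf.2.2 v
      refine ⟨n, ?_⟩
      rw [iter_update h]
      exact hn.resolve_left (fun e => h ⟨n, e⟩)

open Classical in
/-- Number of rooted forests in which `x` has root `t`. -/
noncomputable def cnt [Fintype V] (G : SimpleGraph V) (T : Set V) (x t : V) : ℕ :=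
  (Finset.univ.filter (fun f : V → V => IsPar G T f ∧ Hits f x t)).card

variable [Fintype V] (G : SimpleGraph V) [DecidableRel G.Adj]

open Classical in
lemma cnt_rec {T : Set V} {x t : V} (hx : x ∉ T) (ht : t ∈ T) :
    cnt G T x t = ∑ z ∈ G.neighborFinset x, cnt G (insert x T) z t := by
  unfold cnt
  rw [← Finset.card_sigma]
  have hne : x ≠ t := fun e => hx (e ▸ ht)
  refine Finset.card_bij' (fun f _ => ⟨f x, Function.update f x x⟩)
    (fun p _ => Function.update p.2 x p.1) ?_ ?_ ?_ ?_
  · intro f hf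
    simp only [Finset.mem_filter, Finset.mem_univ, true_and, Finset.mem_sigma,
      SimpleGraph.mem_neighborFinset] at hf ⊢
    refine ⟨hf.1.2.1 x hx, par_cut hf.1 hx, ?_⟩
    rw [hits_update_iff (not_periodic hf.1 hx)]
    exact hits_of_ne hf.2 hne
  · rintro ⟨z, f⟩ hf
    simp only [Finset.mem_filter, Finset.mem_univ, true_and, Finset.mem_sigma,
      SimpleGraph.mem_neighborFinset] at hf ⊢
    exact ⟨par_link hf.2.1 hx hf.1 ht hf.2.2, (hits_link hf.2.1 hx ht hf.2.2).1⟩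
  · intro f hf
    simp
  · rintro ⟨z, f⟩ hf
    simp only [Finset.mem_filter, Finset.mem_univ, true_and, Finset.mem_sigma,
      SimpleGraph.mem_neighborFinset] at hf ⊢
    have : f x = x := hf.2.1.1 x (Or.inl rfl)
    simp [this]

open Classical in
/-- Number of rooted forests. -/
noncomputable def tot (T : Set V) : ℕ :=
  (Finset.univ.filter (fun f : V → V => IsPar G T f)).card

lemma cnt_self {T : Set V} {t : V} : cnt G T t t = tot G T := by
  unfold cnt tot
  congr 1
  ext f
  simp [hits_refl]

lemma cnt_single {x y : V} : cnt G {y} x y = tot G {y} := by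
  unfold cnt tot
  congr 1
  ext f
  simp only [Finset.mem_filter, Finset.mem_univ, true_and, and_iff_left_iff_imp]
  intro hf
  obtain ⟨s, hs, h⟩ := par_hits hf x
  rw [Set.mem_singleton_iff] at hs
  exact hs ▸ h

lemma cnt_zero {T : Set V} {x t : V} (hx : x ∈ T) (h : x ≠ t) : cnt G T x t = 0 := by
  classical
  unfold cnt
  rw [Finset.card_eq_zero, Finset.filter_eq_empty_iff]
  rintro f - ⟨hf, n, hn⟩
  rw [iter_fix (hf.1 x hx)] at hn
  exact h hn

lemma cnt_split {u y z : V} (huy : u ≠ y) :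
    cnt G {u, y} z u + cnt G {u, y} z y = tot G {u, y} := by
  classical
  unfold cnt tot
  rw [← Finset.card_union_of_disjoint]
  · congr 1
    ext f
    simp only [Finset.mem_filter, Finset.mem_univ, true_and, Finset.mem_union]
    constructor
    · rintro (h | h) <;> exact h.1
    · intro hf
      obtain ⟨s, hs, h⟩ := par_hits hf z
      rcases hs with rfl | hs
      · exact Or.inl ⟨hf, h⟩
      · rw [Set.mem_singleton_iff] at hs
        subst hs
        exact Or.inr ⟨hf, h⟩
  · rw [Finset.disjoint_left]
    intro f h1 h2
    simp only [Finset.mem_filter, Finset.mem_univ, true_and] at h1 h2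
    exact huy (root_unique (h1.1.1 u (by simp)) (h1.1.1 y (by simp)) h1.2 h2.2)

lemma swap_mem {u y x z : V} {f : V → V} (huy : u ≠ y) (hxu : x ≠ u) (hxy : x ≠ y)
    (hf : IsPar G {u, y} f) (hz : G.Adj x z) (h1 : Hits f x u) (h2 : Hits f z y) :
    IsPar G {u, y} (Function.update f x z) ∧ G.Adj x (f x) ∧
      Hits (Function.update f x z) x y ∧ Hits (Function.update f x z) (f x) u := by
  have hx : x ∉ ({u, y} : Set V) := by simp [hxu, hxy]
  have hzx : ¬ Hits f z x := fun h => huy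
    (root_unique (hf.1 u (by simp)) (hf.1 y (by simp)) (hits_trans h h1) h2)
  have hc := par_cut hf hx
  have h3 : Hits (Function.update f x x) z y := (hits_update_iff hzx).2 h2
  have e : Function.update (Function.update f x x) x z = Function.update f x z := by simp
  have hl := par_link hc hx hz (by simp) h3
  have hl2 := (hits_link hc hx (by simp) h3).1
  rw [e] at hl hl2
  refine ⟨hl, hf.2.1 x hx, hl2, ?_⟩
  rw [hits_update_iff (not_periodic hf hx)]
  exact hits_of_ne h1 hxu

open Classical in
lemma cnt_harm {u y x : V} (huy : u ≠ y) (hxu : x ≠ u) (hxy : x ≠ y) :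
    ∑ z ∈ G.neighborFinset x, cnt G {u, y} z u = G.degree x * cnt G {u, y} x u := by
  have key : (∑ z ∈ G.neighborFinset x, (Finset.univ.filter (fun f : V → V =>
        IsPar G {u, y} f ∧ Hits f x u ∧ Hits f z y)).card) =
      ∑ z ∈ G.neighborFinset x, (Finset.univ.filter (fun f : V → V =>
        IsPar G {u, y} f ∧ Hits f x y ∧ Hits f z u)).card := by
    rw [← Finset.card_sigma, ← Finset.card_sigma]
    refine Finset.card_bij' (fun p _ => ⟨p.2 x, Function.update p.2 x p.1⟩)
      (fun p _ => ⟨p.2 x, Function.update p.2 x p.1⟩) ?_ ?_ ?_ ?_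
    · rintro ⟨z, f⟩ hf
      simp only [Finset.mem_filter, Finset.mem_univ, true_and, Finset.mem_sigma,
        SimpleGraph.mem_neighborFinset] at hf ⊢
      obtain ⟨a, b, c, d⟩ := swap_mem G huy hxu hxy hf.2.1 hf.1 hf.2.2.1 hf.2.2.2
      exact ⟨b, a, c, d⟩
    · rintro ⟨z, f⟩ hf
      simp only [Finset.mem_filter, Finset.mem_univ, true_and, Finset.mem_sigma,
        SimpleGraph.mem_neighborFinset] at hf ⊢
      rw [Set.pair_comm] at hf ⊢
      obtain ⟨a, b, c, d⟩ := swap_mem G huy.symm hxy hxu hf.2.1 hf.1 hf.2.2.1 hf.2.2.2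
      exact ⟨b, a, c, d⟩
    · rintro ⟨z, f⟩ hf
      simp
    · rintro ⟨z, f⟩ hf
      simp
  have s1 : ∀ z, cnt G {u, y} z u = (Finset.univ.filter (fun f : V → V =>
        IsPar G {u, y} f ∧ Hits f x u ∧ Hits f z u)).card + (Finset.univ.filter (fun f : V → V =>
        IsPar G {u, y} f ∧ Hits f x y ∧ Hits f z u)).card := by
    intro z
    unfold cnt
    rw [← Finset.card_union_of_disjoint]
    · congr 1
      ext f
      simp only [Finset.mem_filter, Finset.mem_univ, true_and, Finset.mem_union]
      constructor
      · rintro ⟨hf, h⟩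
        obtain ⟨s, hs, h'⟩ := par_hits hf x
        rcases hs with rfl | hs
        · exact Or.inl ⟨hf, h', h⟩
        · rw [Set.mem_singleton_iff] at hs
          subst hs
          exact Or.inr ⟨hf, h', h⟩
      · tauto
    · rw [Finset.disjoint_left]
      intro f h1 h2
      simp only [Finset.mem_filter, Finset.mem_univ, true_and] at h1 h2
      exact huy (root_unique (h1.1.1 u (by simp)) (h1.1.1 y (by simp)) h1.2.1 h2.2.1)
  have s2 : ∀ z, cnt G {u, y} x u = (Finset.univ.filter (fun f : V → V =>
        IsPar G {u, y} f ∧ Hits f x u ∧ Hits f z u)).card + (Finset.univ.filter (fun f : V → V =>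
        IsPar G {u, y} f ∧ Hits f x u ∧ Hits f z y)).card := by
    intro z
    unfold cnt
    rw [← Finset.card_union_of_disjoint]
    · congr 1
      ext f
      simp only [Finset.mem_filter, Finset.mem_univ, true_and, Finset.mem_union]
      constructor
      · rintro ⟨hf, h⟩
        obtain ⟨s, hs, h'⟩ := par_hits hf z
        rcases hs with rfl | hs
        · exact Or.inl ⟨hf, h, h'⟩
        · rw [Set.mem_singleton_iff] at hs
          subst hs
          exact Or.inr ⟨hf, h, h'⟩
      · tauto
    · rw [Finset.disjoint_left]
      intro f h1 h2
      simp only [Finset.mem_filter, Finset.mem_univ, true_and] at h1 h2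
      exact huy (root_unique (h1.1.1 u (by simp)) (h1.1.1 y (by simp)) h1.2.2 h2.2.2)
  have s3 : G.degree x * cnt G {u, y} x u = ∑ z ∈ G.neighborFinset x, cnt G {u, y} x u := by
    simp
  rw [s3, Finset.sum_congr rfl (fun z _ => s1 z), Finset.sum_congr rfl (fun z _ => s2 z),
    Finset.sum_add_distrib, Finset.sum_add_distrib, key]

lemma cnt_pole {u y : V} (huy : u ≠ y) :
    ∑ z ∈ G.neighborFinset u, cnt G {u, y} z u + tot G {y} = G.degree u * tot G {u, y} := by
  rw [← cnt_single G (x := u), cnt_rec G (T := {y}) (x := u) (t := y) (by simpa using huy) (by simp),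
    ← Finset.sum_add_distrib, Finset.sum_congr rfl (fun z _ => cnt_split G (z := z) huy)]
  simp

/-- The graph of a parent function. -/
def gr (f : V → V) : SimpleGraph V := SimpleGraph.fromRel (fun a b => f a = b)

lemma gr_adj {f : V → V} {a b : V} : (gr f).Adj a b ↔ a ≠ b ∧ (f a = b ∨ f b = a) := by
  simp [gr]

lemma gr_reach {f : V → V} {a b : V} (h : Hits f a b) : (gr f).Reachable a b := by
  obtain ⟨n, hn⟩ := h
  induction n generalizing a with
  | zero => exact hn ▸ SimpleGraph.Reachable.refl _
  | succ n ih =>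
    refine SimpleGraph.Reachable.trans ?_ (ih (a := f a) hn)
    by_cases e : a = f a
    · rw [← e]
    · exact SimpleGraph.Adj.reachable (gr_adj.2 ⟨e, Or.inl rfl⟩)

lemma closed_of_reach {F : SimpleGraph V} {D : V → Prop}
    (hD : ∀ a b, F.Adj a b → D a → D b) {a b : V} (h : F.Reachable a b) (ha : D a) : D b := by
  obtain ⟨p⟩ := h
  induction p with
  | nil => exact ha
  | cons h p ih => exact ih (hD _ _ h ha)

lemma gr_le {S : Set V} {f : V → V} (hf : IsPar G S f) : gr f ≤ G := by
  have key : ∀ a b, a ≠ b → f a = b → G.Adj a b := by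
    intro a b hne h
    have : a ∉ S := fun ha => hne ((hf.1 a ha).symm.trans h)
    exact h ▸ hf.2.1 a this
  intro a b h
  rw [gr_adj] at h
  rcases h with ⟨hne, h | h⟩
  · exact key a b hne h
  · exact (key b a hne.symm h).symm

lemma gr_sep {S : Set V} {f : V → V} (hf : IsPar G S f) {s t : V} (hs : s ∈ S) (ht : t ∈ S)
    (h : (gr f).Reachable s t) : s = t := by
  have hD : ∀ a b, (gr f).Adj a b → Hits f a s → Hits f b s := by
    intro a b hab ha
    rw [gr_adj] at hab
    rcases hab with ⟨hne, h1 | h1⟩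
    · by_cases e : a = s
      · subst e
        exact absurd ((hf.1 a hs).symm.trans h1) hne
      · exact h1 ▸ hits_of_ne ha e
    · exact hits_trans (h1 ▸ hits_step f b) ha
  have := closed_of_reach hD h (hits_refl f s)
  exact root_unique (hf.1 s hs) (hf.1 t ht) this (hits_refl f t)

lemma gr_bridge {S : Set V} {f : V → V} (hf : IsPar G S f) {v : V} (hv : v ≠ f v) :
    (gr f).IsBridge s(v, f v) := by
  rw [SimpleGraph.isBridge_iff]
  intro h
  have hvS : v ∉ S := fun h => hv (hf.1 v h).symm
  refine not_periodic hf hvS (closed_of_reach (D := fun w => Hits f w v) ?_ h (hits_refl f v))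
  intro a b hab ha
  rw [SimpleGraph.deleteEdges_adj, gr_adj] at hab
  obtain ⟨⟨hne, h1 | h1⟩, hn⟩ := hab
  · by_cases e : a = v
    · subst e; subst h1
      exact absurd rfl hn
    · exact h1 ▸ hits_of_ne ha e
  · exact hits_trans (h1 ▸ hits_step f b) ha

lemma gr_acyclic {S : Set V} {f : V → V} (hf : IsPar G S f) : (gr f).IsAcyclic := by
  rw [SimpleGraph.isAcyclic_iff_forall_adj_isBridge]
  intro a b hab
  rw [gr_adj] at hab
  rcases hab with ⟨hne, rfl | rfl⟩
  · exact gr_bridge G hf hne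
  · rw [Sym2.eq_swap]
    exact gr_bridge G hf hne.symm

lemma gr_inj {S : Set V} {f g : V → V} (hf : IsPar G S f) (hg : IsPar G S g)
    (h : gr f = gr g) : f = g := by
  have key : ∀ n v, f^[n] v ∈ S → f v = g v := by
    intro n
    induction n with
    | zero => intro v hv; exact (hf.1 v hv).trans (hg.1 v hv).symm
    | succ n ih =>
      intro v hv
      by_cases hvS : v ∈ S
      · exact (hf.1 v hvS).trans (hg.1 v hvS).symm
      · have h1 := ih (f v) hv
        have hadj : (gr f).Adj v (f v) := gr_adj.2 ⟨(hf.2.1 v hvS).ne, Or.inl rfl⟩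
        rw [h, gr_adj] at hadj
        rcases hadj.2 with h2 | h2
        · exact h2.symm
        · exact absurd ⟨1, h1.trans h2⟩ (not_periodic hf hvS)
  funext v
  obtain ⟨n, hn⟩ := hf.2.2 v
  exact key n v hn

lemma gr_surj {S : Set V} {F : SimpleGraph V} (hle : F ≤ G) (hac : F.IsAcyclic)
    (hsep : ∀ u ∈ S, ∀ v ∈ S, u ≠ v → ¬F.Reachable u v)
    (hr : ∀ w : V, ∃ u ∈ S, F.Reachable w u) : ∃ f, IsPar G S f ∧ gr f = F := by
  classical
  choose r hrS hrr using hr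
  have hroot : ∀ a b, F.Reachable a b → r a = r b := by
    intro a b hab
    by_contra hne
    exact hsep _ (hrS a) _ (hrS b) hne ((hrr a).symm.trans (hab.trans (hrr b)))
  have hrs : ∀ s ∈ S, r s = s := by
    intro s hs
    by_contra hne
    exact hsep _ (hrS s) _ hs hne (hrr s).symm
  have hnext : ∀ v, ∃ w, v ∉ S → F.Adj v w ∧ F.dist w (r v) < F.dist v (r v) := by
    intro v
    by_cases hv : v ∈ S
    · exact ⟨v, fun h => absurd hv h⟩
    · obtain ⟨p, hp⟩ := (hrr v).exists_walk_length_eq_dist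
      have hne : v ≠ r v := fun e => hv (e ▸ hrS v)
      generalize r v = t at p hp hne
      cases p with
      | nil => exact absurd rfl hne
      | @cons _ w _ h q =>
        refine ⟨w, fun _ => ⟨h, ?_⟩⟩
        rw [← hp, SimpleGraph.Walk.length_cons]
        exact Nat.lt_succ_of_le (SimpleGraph.dist_le q)
  choose nx hnx using hnext
  let f : V → V := fun v => if v ∈ S then v else nx v
  have fS : ∀ s ∈ S, f s = s := fun s hs => if_pos hs
  have fN : ∀ s, s ∉ S → f s = nx s := fun s hs => if_neg hs
  have hreach : ∀ k v, F.dist v (r v) = k → ∃ n : ℕ, f^[n] v ∈ S := by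
    intro k
    induction k using Nat.strong_induction_on with
    | _ k ih =>
      intro v hk
      by_cases hv : v ∈ S
      · exact ⟨0, hv⟩
      · obtain ⟨h1, h2⟩ := hnx v hv
        rw [hroot _ _ h1.reachable, ← hroot _ _ h1.reachable] at h2
        have h3 : r v = r (nx v) := hroot _ _ h1.reachable
        obtain ⟨n, hn⟩ := ih (F.dist (nx v) (r (nx v))) (by rw [← hk, ← h3]; exact h2) (nx v) rfl
        exact ⟨n + 1, by rw [Function.iterate_succ_apply, fN v hv]; exact hn⟩
  have hf : IsPar G S f := ⟨fS, fun v hv => by rw [fN v hv]; exact hle (hnx v hv).1,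
    fun v => hreach _ v rfl⟩
  have key : ∀ a b, a ≠ b → f a = b → F.Adj a b := by
    intro a b hne h
    have ha : a ∉ S := fun ha => hne ((fS a ha).symm.trans h)
    rw [fN a ha] at h
    exact h ▸ (hnx a ha).1
  have hgle : gr f ≤ F := by
    intro a b h
    rw [gr_adj] at h
    rcases h with ⟨hne, h | h⟩
    · exact key a b hne h
    · exact (key b a hne.symm h).symm
  refine ⟨f, hf, le_antisymm hgle ?_⟩
  intro a b hab
  by_contra hn
  have hb := (SimpleGraph.isAcyclic_iff_forall_adj_isBridge.1 hac) hab
  rw [SimpleGraph.isBridge_iff] at hb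
  apply hb
  have hle2 : gr f ≤ F.deleteEdges {s(a, b)} := by
    intro c d hcd
    rw [SimpleGraph.deleteEdges_adj]
    refine ⟨hgle hcd, fun e => hn ?_⟩
    rw [Set.mem_singleton_iff] at e
    rwa [← SimpleGraph.mem_edgeSet, ← e, SimpleGraph.mem_edgeSet]
  refine SimpleGraph.Reachable.mono hle2 ?_
  have hh : ∀ c, (gr f).Reachable c (r c) := by
    intro c
    obtain ⟨s, hs, hc⟩ := par_hits hf c
    have h1 := gr_reach hc
    have : r c = s := (hroot _ _ (h1.mono hgle)).trans (hrs s hs)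
    rwa [this]
  have h2 := hh b
  rw [← hroot _ _ hab.reachable] at h2
  exact (hh a).trans h2.symm

lemma tot_eq (S : Set V) : contractedTreeCount G S = tot G S := by
  classical
  have h1 : tot G S = Nat.card {f : V → V // IsPar G S f} := by
    rw [Nat.card_eq_fintype_card, Fintype.card_subtype]
    unfold tot
    congr
  rw [h1, contractedTreeCount]
  symm
  refine Nat.card_congr (Equiv.ofBijective (fun f => ⟨gr f.1, gr_le G f.2, gr_acyclic G f.2,
    fun u hu v hv hne h => hne (gr_sep G f.2 hu hv h), fun w => ?_⟩) ⟨?_, ?_⟩)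
  · obtain ⟨s, hs, h⟩ := par_hits f.2 w
    exact ⟨s, hs, gr_reach h⟩
  · intro f g h
    exact Subtype.ext (gr_inj G f.2 g.2 (congrArg Subtype.val h))
  · rintro ⟨F, a, b, c, d⟩
    obtain ⟨f, hf, e⟩ := gr_surj G a b c d
    exact ⟨⟨f, hf⟩, Subtype.ext e⟩

lemma tree_eq (y : V) : spanningTreeCount G = tot G {y} := by
  rw [← tot_eq, spanningTreeCount, contractedTreeCount]
  refine Nat.card_congr (Equiv.subtypeEquivRight ?_)
  intro T
  constructor
  · rintro ⟨a, b, c⟩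
    refine ⟨a, c, ?_, fun w => ⟨y, rfl, b.preconnected w y⟩⟩
    rintro u rfl v rfl h
    exact absurd rfl h
  · rintro ⟨a, b, -, d⟩
    have hy : ∀ w, T.Reachable w y := by
      intro w
      obtain ⟨u, rfl, h⟩ := d w
      exact h
    haveI : Nonempty V := ⟨y⟩
    exact ⟨a, ⟨fun u v => (hy u).trans (hy v).symm⟩, b⟩

lemma tree_pos (hG : G.Connected) : 0 < spanningTreeCount G := by
  obtain ⟨T, hT, h⟩ := hG.exists_isTree_le
  unfold spanningTreeCount
  haveI : Nonempty {T : SimpleGraph V // T ≤ G ∧ T.Connected ∧ T.IsAcyclic} :=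
    ⟨⟨T, hT, h.1, h.2⟩⟩
  exact Nat.card_pos

lemma path_sum {x u : V} (hxu : x ≠ u) (φ : List V → ℕ) :
    ∑ P : G.Path x u, φ P.1.support = ∑ z ∈ G.neighborFinset x,
      ∑ Q : G.Path z u, if x ∈ Q.1.support then 0 else φ (x :: Q.1.support) := by
  rw [Finset.sum_sigma']
  symm
  have hh : ∀ (s : Finset ((z : V) × G.Path z u)) ,
    (∑ q ∈ s, if x ∈ q.2.1.support then 0 else φ (x :: q.2.1.support)) =
    ∑ q ∈ s with x ∉ q.2.1.support, φ (x :: q.2.1.support) := by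
    intro s
    rw [Finset.sum_filter]
    refine Finset.sum_congr rfl fun q _ => ?_
    by_cases h : x ∈ q.2.1.support <;> simp [h]
  rw [hh]
  refine Finset.sum_bij (fun q hq => ⟨SimpleGraph.Walk.cons (u := x) (v := q.1)
    (by simpa using (Finset.mem_sigma.1 (Finset.mem_filter.1 hq).1).1) q.2.1,
    (SimpleGraph.Walk.cons_isPath_iff _ _).2 ⟨q.2.2, (Finset.mem_filter.1 hq).2⟩⟩) ?_ ?_ ?_ ?_
  · intros; simp
  · rintro ⟨z, Q, hQ⟩ h1 ⟨z', Q', hQ'⟩ h2 h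
    simp only [Subtype.mk.injEq, SimpleGraph.Walk.cons.injEq] at h
    obtain ⟨rfl, h⟩ := h
    simp only [heq_eq_eq] at h
    subst h
    rfl
  · rintro ⟨P, hP⟩ -
    cases P with
    | nil => exact absurd rfl hxu
    | @cons _ z _ h q =>
      rw [SimpleGraph.Walk.cons_isPath_iff] at hP
      refine ⟨⟨z, q, hP.1⟩, ?_, rfl⟩
      simp [h, hP.2]
  · intros; simp

open Classical in
lemma path_cnt (k : ℕ) (S : Set V) (x u : V) (hk : (Sᶜ).ncard = k) (hu : u ∉ S) :
    (∑ P : G.Path x u, if (∃ v ∈ P.1.support, v ∈ S) then 0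
      else tot G ({v | v ∈ P.1.support} ∪ S)) = cnt G (insert u S) x u := by
  induction k using Nat.strong_induction_on generalizing S x with
  | _ k ih =>
  by_cases hxu : x = u
  · subst hxu
    rw [cnt_self]
    have : ∀ P : G.Path x x, P = SimpleGraph.Path.nil := fun P => SimpleGraph.Path.loop_eq P
    letI hU : Unique (G.Path x x) := ⟨⟨SimpleGraph.Path.nil⟩, this⟩
    rw [Fintype.sum_unique, this default]
    have e : ({x} ∪ S : Set V) = insert x S := rfl
    simp [SimpleGraph.Path.nil, hu]
  · by_cases hx : x ∈ S
    · rw [cnt_zero G (Or.inr hx) hxu]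
      refine Finset.sum_eq_zero fun P _ => if_pos ⟨x, by simp, hx⟩
    · rw [cnt_rec G (x := x) (t := u) (by simp [hxu, hx]) (by simp)]
      rw [path_sum G hxu (fun l => if (∃ v ∈ l, v ∈ S) then 0 else tot G ({v | v ∈ l} ∪ S))]
      refine Finset.sum_congr rfl fun z _ => ?_
      rw [Set.insert_comm, ← ih (((insert x S)ᶜ).ncard) ?_ (insert x S) z rfl (by simp [Ne.symm hxu, hu])]
      · refine Finset.sum_congr rfl fun Q _ => ?_
        have e : ({v | v ∈ x :: Q.1.support} ∪ S : Set V) = {v | v ∈ Q.1.support} ∪ insert x S := by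
          ext v
          simp only [List.mem_cons, Set.mem_union, Set.mem_ofPred_eq, Set.mem_insert_iff]
          tauto
        rw [e]
        by_cases h1 : x ∈ Q.1.support
        · rw [if_pos h1, if_pos ⟨x, h1, Or.inl rfl⟩]
        · rw [if_neg h1]
          have hiff : (∃ v ∈ x :: Q.1.support, v ∈ S) ↔ ∃ v ∈ Q.1.support, v ∈ insert x S := by
            constructor
            · rintro ⟨v, hv, hvS⟩
              rcases List.mem_cons.1 hv with rfl | hv
              · exact absurd hvS hx
              · exact ⟨v, hv, Or.inr hvS⟩
            · rintro ⟨v, hv, rfl | hvS⟩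
              · exact absurd hv h1
              · exact ⟨v, List.mem_cons_of_mem _ hv, hvS⟩
          by_cases h2 : ∃ v ∈ Q.1.support, v ∈ insert x S
          · rw [if_pos h2, if_pos (hiff.2 h2)]
          · rw [if_neg h2, if_neg (fun h => h2 (hiff.1 h))]
      · rw [← hk]
        refine Set.ncard_lt_ncard ?_ (Set.toFinite _)
        refine ⟨fun v hv hvS => hv (Or.inr hvS), fun h => h hx (Or.inl rfl)⟩

/-- The inner sum of the formula. -/
noncomputable def inner' (x y u : V) : ℝ :=
  ∑ P : G.Path x u, if y ∈ P.1.support then 0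
        else (contractedTreeCount G ({v | v ∈ P.1.support} ∪ {y}) : ℝ)

lemma inner_eq {x y u : V} (h : u ≠ y) : inner' G x y u = cnt G {u, y} x u := by
  classical
  have := path_cnt G _ {y} x u rfl (by simpa using h)
  rw [← this]
  unfold inner'
  push_cast
  refine Finset.sum_congr rfl fun P _ => ?_
  rw [tot_eq]
  simp

lemma inner_zero {x y : V} : inner' G x y y = 0 := by
  unfold inner'
  exact Finset.sum_eq_zero fun P _ => if_pos (by simp)

lemma inner_zero' {y u : V} : inner' G y y u = 0 := by
  unfold inner'
  exact Finset.sum_eq_zero fun P _ => if_pos (by simp)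

lemma inner_lap {x y u : V} (hxy : x ≠ y) :
    G.degree x * inner' G x y u - ∑ z ∈ G.neighborFinset x, inner' G z y u =
      if u = x then (spanningTreeCount G : ℝ) else 0 := by
  by_cases huy : u = y
  · subst huy
    simp [inner_zero, Ne.symm hxy]
  · simp only [inner_eq G huy]
    split_ifs with h
    · subst h
      have := cnt_pole G huy
      rw [tree_eq G y, cnt_self, ← Nat.cast_mul, ← this]
      push_cast
      ring
    · have := cnt_harm G huy (Ne.symm h) hxy
      rw [← Nat.cast_mul, ← this]
      push_cast
      ring

lemma unique_sol (hG : G.Connected) (y : V) (D : V → ℝ) (hy : D y = 0)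
    (hD : ∀ x, x ≠ y → G.degree x * D x - ∑ z ∈ G.neighborFinset x, D z = 0) (x : V) :
    D x = 0 := by
  have h1 : ∀ x, x ≠ y → (G.lapMatrix ℝ).mulVec D x = 0 := by
    intro x hx
    rw [SimpleGraph.lapMatrix_mulVec_apply]
    exact hD x hx
  have h2 : ∑ v, (G.lapMatrix ℝ).mulVec D v = 0 := by
    have : (fun _ => (1:ℝ)) ⬝ᵥ (G.lapMatrix ℝ).mulVec D = 0 := by
      rw [Matrix.dotProduct_mulVec, ← Matrix.mulVec_transpose,
        (SimpleGraph.isSymm_lapMatrix (R := ℝ) G).eq, SimpleGraph.lapMatrix_mulVec_const_eq_zero]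
      simp
    simpa [dotProduct] using this
  rw [Finset.sum_eq_single y (fun b _ hb => h1 b hb) (by simp)] at h2
  have h3 : (G.lapMatrix ℝ).mulVec D = 0 := by
    funext v
    by_cases hv : v = y
    · rw [hv]; exact h2
    · exact h1 v hv
  rw [SimpleGraph.lapMatrix_mulVec_eq_zero_iff_forall_reachable] at h3
  rw [h3 x y (hG.preconnected x y), hy]

end HT

/-- Explicit formula for hitting times: $H(x,y)=\frac{1}{\tau(G)}\sum_u d_u
\sum_{P\in\mathscr P_G(x,u), y\notin P}\tau(G/\{P,y\})$. -/
theorem hitting_time_formula {V : Type*} [Fintype V] [DecidableEq V] (G : SimpleGraph V)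
    [DecidableRel G.Adj] (hG : G.Connected) (H : V → V → ℝ)
    (hH : IsHittingTime G H) (x y : V) :
    H x y = (1 / (spanningTreeCount G : ℝ)) * ∑ u : V, (G.degree u : ℝ) *
      ∑ P : G.Path x u, if y ∈ P.1.support then 0
        else (contractedTreeCount G ({v | v ∈ P.1.support} ∪ {y}) : ℝ) := by
  have hpos : (spanningTreeCount G : ℝ) ≠ 0 := by
    exact_mod_cast (HT.tree_pos G hG).ne'
  set τ : ℝ := (spanningTreeCount G : ℝ) with hτ
  change H x y = (1 / τ) * ∑ u : V, (G.degree u : ℝ) * HT.inner' G x y u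
  rw [← sub_eq_zero]
  refine HT.unique_sol G hG y
    (fun x => H x y - (1 / τ) * ∑ u : V, (G.degree u : ℝ) * HT.inner' G x y u) ?_ ?_ x
  · simp [hH.1 y, HT.inner_zero']
  · intro x hxy
    have hdeg : (G.degree x : ℝ) ≠ 0 := by
      haveI : Nontrivial V := ⟨x, y, hxy⟩
      exact_mod_cast (hG.preconnected.degree_pos_of_nontrivial x).ne'
    have h1 : (G.degree x : ℝ) * H x y - ∑ z ∈ G.neighborFinset x, H z y = G.degree x := by
      rw [hH.2 x y hxy]
      field_simp
      ring
    have h2 : (G.degree x : ℝ) * ∑ u : V, (G.degree u : ℝ) * HT.inner' G x y u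
        - ∑ z ∈ G.neighborFinset x, ∑ u : V, (G.degree u : ℝ) * HT.inner' G z y u
        = G.degree x * τ := by
      rw [Finset.sum_comm, Finset.mul_sum, ← Finset.sum_sub_distrib]
      have : ∀ u : V, (G.degree x : ℝ) * ((G.degree u : ℝ) * HT.inner' G x y u)
          - ∑ z ∈ G.neighborFinset x, (G.degree u : ℝ) * HT.inner' G z y u
          = G.degree u * (if u = x then τ else 0) := by
        intro u
        rw [← HT.inner_lap G hxy, ← Finset.mul_sum]
        ring
      rw [Finset.sum_congr rfl (fun u _ => this u)]
      simp
    simp only [Finset.sum_sub_distrib, ← Finset.mul_sum]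
    have h3 : (1 / τ) * (G.degree x * τ) = G.degree x := by field_simp
    rw [← h2] at h3
    linear_combination h1 - h3
end

section
/- Tetali's formula: for a random walk on a connected graph G, H(i,j) = (1/2)[κ(i,j) + Σ_{q ∈ V(G)} (d_q / vol(G)) · (κ(q,j) - κ(q,i))], where κ(x,y) = H(x,y) + H(y,x) is the commute time and vol(G) = Σ_v d_v. -/
/-- Tetali's formula. -/
theorem tetali_formula {V : Type*} [Fintype V] (G : SimpleGraph V)
    [DecidableRel G.Adj] (hG : G.Connected) (H : V → V → ℝ)
    (hH : IsHittingTime G H) (i j : V) :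
    H i j = (1 / 2) * ((H i j + H j i) +
      ∑ q : V, ((G.degree q : ℝ) / (∑ v : V, (G.degree v : ℝ))) *
        ((H q j + H j q) - (H q i + H i q))) := by
  classical
  obtain ⟨h0, h1⟩ := hH
  by_cases hij : i = j
  · subst hij
    simp [h0]
  have : Nontrivial V := ⟨i, j, hij⟩
  have hdpos : ∀ x, (0 : ℝ) < G.degree x := fun x => by
    exact_mod_cast hG.preconnected.degree_pos_of_nontrivial x
  obtain ⟨d, hd⟩ : ∃ d : V → ℝ, d = fun x => (G.degree x : ℝ) := ⟨_, rfl⟩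
  obtain ⟨a, ha⟩ : ∃ a : V → V → ℝ, a = fun x z => if G.Adj x z then (1 : ℝ) else 0 := ⟨_, rfl⟩
  have hsymm : ∀ x z, a x z = a z x := fun x z => by simp [ha, G.adj_comm x z]
  have hrow : ∀ x, ∑ z, a x z = d x := fun x => by
    simp only [ha, hd, Finset.sum_boole, ← SimpleGraph.card_neighborFinset_eq_degree,
      SimpleGraph.neighborFinset_eq_filter]
  have hnb : ∀ x (f : V → ℝ), ∑ z ∈ G.neighborFinset x, f z = ∑ z, a x z * f z := fun x f => by
    simp [ha, SimpleGraph.neighborFinset_eq_filter, Finset.sum_filter]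
  have hsa : ∀ f g : V → ℝ, ∑ x, f x * ∑ z, a x z * g z = ∑ x, g x * ∑ z, a x z * f z := by
    intro f g
    simp only [Finset.mul_sum]
    rw [Finset.sum_comm]
    refine Finset.sum_congr rfl fun x _ => Finset.sum_congr rfl fun z _ => ?_
    rw [hsymm z x]; ring
  obtain ⟨W, hW⟩ : ∃ W : ℝ, W = ∑ v, d v := ⟨_, rfl⟩
  have hWpos : 0 < W := by
    rw [hW]
    refine Finset.sum_pos (fun x _ => ?_) ⟨i, Finset.mem_univ i⟩
    rw [hd]; exact hdpos x
  have hoff : ∀ x y, x ≠ y → d x * H x y - ∑ z, a x z * H z y - d x = 0 := by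
    intro x y hxy
    have h := h1 x y hxy
    rw [hnb x (fun z => H z y)] at h
    have hp := hdpos x
    rw [h, hd]
    field_simp
    ring
  have hr : ∀ x y, d x * H x y - ∑ z, a x z * H z y - d x = if x = y then -W else 0 := by
    intro x y
    split_ifs with hxy
    · subst hxy
      have hs : ∑ t, (d t * H t x - ∑ z, a t z * H z x - d t) = -W := by
        have h := hsa (fun _ => 1) (fun z => H z x)
        simp only [one_mul, mul_one, hrow] at h
        rw [Finset.sum_sub_distrib, Finset.sum_sub_distrib, h, hW]
        simp only [mul_comm (d _)]
        ring
      rw [← hs]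
      symm
      exact Finset.sum_eq_single x (fun t _ ht => hoff t x ht) (by simp)
    · exact hoff x y hxy
  have key : ∀ p q, ∑ x, d x * H x p - W * H q p = ∑ x, d x * H x q - W * H p q := by
    have e : ∀ p q, ∑ x, H x p * (d x * H x q) - ∑ x, H x p * ∑ z, a x z * H z q
        - ∑ x, d x * H x p = - W * H q p := by
      intro p q
      have : ∑ x, H x p * (d x * H x q - ∑ z, a x z * H z q - d x) = - W * H q p := by
        simp only [hr]
        simp [mul_comm]
      rw [← this, ← Finset.sum_sub_distrib, ← Finset.sum_sub_distrib]
      exact Finset.sum_congr rfl fun x _ => by ring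
    intro p q
    have e1 := e p q
    have e2 := e q p
    have e3 := hsa (fun x => H x p) (fun x => H x q)
    have e4 : ∑ x, H x p * (d x * H x q) = ∑ x, H x q * (d x * H x p) :=
      Finset.sum_congr rfl fun x _ => by ring
    linarith
  obtain ⟨A, hA⟩ : ∃ A : V → ℝ, A = fun p => ∑ x, d x * H x p := ⟨_, rfl⟩
  have key' : ∀ p q, A p - W * H q p = A q - W * H p q := fun p q => by rw [hA]; exact key p q
  have hB : ∀ p, W * ∑ q, d q * H p q = ∑ q, d q * A q := by
    intro p
    have h : ∀ q, W * (d q * H p q) = d q * A q - d q * A p + W * (d q * H q p) := fun q => by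
      linear_combination (d q) * key' p q
    have hAp : A p = ∑ x, d x * H x p := by rw [hA]
    rw [Finset.mul_sum, Finset.sum_congr rfl fun q _ => h q, Finset.sum_add_distrib,
      Finset.sum_sub_distrib, ← Finset.sum_mul, ← Finset.mul_sum, ← hW, ← hAp]
    ring
  have hBij : ∑ q, d q * H j q = ∑ q, d q * H i q :=
    mul_left_cancel₀ hWpos.ne' ((hB j).trans (hB i).symm)
  have hfin : ∑ q, d q / W * ((H q j + H j q) - (H q i + H i q)) = H i j - H j i := by
    have h : ∀ q, d q / W * ((H q j + H j q) - (H q i + H i q))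
        = (d q * H q j + d q * H j q - d q * H q i - d q * H i q) / W := fun q => by ring
    rw [Finset.sum_congr rfl fun q _ => h q, ← Finset.sum_div, Finset.sum_sub_distrib,
      Finset.sum_sub_distrib, Finset.sum_add_distrib, hBij, div_eq_iff hWpos.ne']
    linear_combination -key i j
  rw [hW, hd] at hfin
  rw [hfin]
  ring
end

section
/- For distinct vertices x, y of a connected graph G, the commute time satisfies κ(x,y) = vol(G) · τ(G')/τ(G), where G' is the multigraph obtained from G by identifying x and y. -/
namespace CTTR
open SimpleGraph Finset

/-- Delete the edge `uz`. -/
def D {V : Type*} (T : SimpleGraph V) (u z : V) : SimpleGraph V := T.deleteEdges {s(u, z)}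

/-- Spanning forest with two components separating `x` and `y`. -/
def IsF {V : Type*} (G : SimpleGraph V) (x y : V) (F : SimpleGraph V) : Prop :=
  F ≤ G ∧ F.IsAcyclic ∧ ¬ F.Reachable x y ∧ ∀ w, F.Reachable w x ∨ F.Reachable w y

/-- Spanning tree. -/
def IsT {V : Type*} (G : SimpleGraph V) (T : SimpleGraph V) : Prop :=
  T ≤ G ∧ T.Connected ∧ T.IsAcyclic

variable {V : Type*}

lemma D_le (T : SimpleGraph V) (u z : V) : D T u z ≤ T := deleteEdges_le _

lemma D_adj (T : SimpleGraph V) (u z a b : V) :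
    (D T u z).Adj a b ↔ T.Adj a b ∧ s(a, b) ≠ s(u, z) := by
  simp [D, deleteEdges_adj]

lemma D_not_reach {T : SimpleGraph V} (hT : T.IsAcyclic) {u z : V} (h : T.Adj u z) :
    ¬ (D T u z).Reachable u z :=
  isBridge_iff.1 (isAcyclic_iff_forall_adj_isBridge.1 hT h)

lemma D_side {T : SimpleGraph V} {u z w : V} (h : T.Reachable w u) :
    (D T u z).Reachable w u ∨ (D T u z).Reachable w z := by
  obtain ⟨p⟩ := h
  induction p with
  | nil => exact Or.inl (Reachable.refl _)
  | @cons a b c hab p ih =>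
    by_cases he : s(a, b) = s(c, z)
    · rcases Sym2.eq_iff.1 he with ⟨rfl, rfl⟩ | ⟨rfl, rfl⟩
      · exact Or.inl (Reachable.refl _)
      · exact Or.inr (Reachable.refl _)
    · have h1 : (D T c z).Reachable a b := ((D_adj T c z a b).2 ⟨hab, he⟩).reachable
      exact ih.imp h1.trans h1.trans

lemma IsT.side {G T : SimpleGraph V} (hT : IsT G T) (u z w : V) :
    (D T u z).Reachable w u ∨ (D T u z).Reachable w z :=
  D_side (hT.2.1.preconnected w u)

lemma D_sup {F : SimpleGraph V} {u z : V} (h : ¬ F.Reachable u z) : D (F ⊔ edge u z) u z = F := by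
  have h1 : ¬ F.Adj u z := fun h' => h h'.reachable
  ext a b
  rw [D_adj, sup_adj, edge_adj]
  constructor
  · rintro ⟨h2 | ⟨h2, _⟩, h3⟩
    · exact h2
    · exact absurd (Sym2.eq_iff.2 h2) h3
  · intro h2
    refine ⟨Or.inl h2, fun he => ?_⟩
    rcases Sym2.eq_iff.1 he with ⟨rfl, rfl⟩ | ⟨rfl, rfl⟩
    · exact h1 h2
    · exact h1 h2.symm

lemma sup_D {T : SimpleGraph V} {u z : V} (h : T.Adj u z) : D T u z ⊔ edge u z = T := by
  ext a b
  rw [sup_adj, D_adj, edge_adj]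
  constructor
  · rintro (h2 | ⟨⟨rfl, rfl⟩ | ⟨rfl, rfl⟩, _⟩)
    · exact h2.1
    · exact h
    · exact h.symm
  · intro h2
    by_cases he : s(a, b) = s(u, z)
    · exact Or.inr ⟨Sym2.eq_iff.1 he, h2.ne⟩
    · exact Or.inl ⟨h2, he⟩

/-- Unique exit edge from `u` towards `x`. -/
lemma exit_unique {G T : SimpleGraph V} (hT : IsT G T) {u x : V} (hux : u ≠ x) :
    ∃! z, T.Adj u z ∧ (D T u z).Reachable z x := by
  classical
  have key : ∀ z, T.Adj u z → (D T u z).Reachable z x →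
      ∃ p : T.Walk u x, p.IsPath ∧ p.snd = z := by
    intro z hz hr
    obtain ⟨q, hq⟩ := hr.exists_isPath
    have hu : u ∉ q.support := fun hmem =>
      D_not_reach hT.2.2 hz (q.takeUntil u hmem).reachable.symm
    refine ⟨Walk.cons hz (q.mapLe (D_le T u z)), ?_, by simp⟩
    rw [Walk.cons_isPath_iff]
    refine ⟨(Walk.isPath_mapLe _).2 hq, ?_⟩
    simpa using hu
  obtain ⟨p, hp⟩ := (hT.2.1.preconnected u x).exists_isPath
  cases p with
  | nil => exact absurd rfl hux
  | @cons _ b _ hab p =>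
    rw [Walk.cons_isPath_iff] at hp
    refine ⟨b, ⟨hab, ?_⟩, ?_⟩
    · refine reachable_deleteEdges_iff_exists_walk.2 ⟨p, fun hmem => ?_⟩
      exact hp.2 (Walk.fst_mem_support_of_mem_edges p hmem)
    · rintro z ⟨hz, hr⟩
      obtain ⟨q, hq, rfl⟩ := key z hz hr
      have := hT.2.2.path_unique ⟨q, hq⟩ ⟨Walk.cons hab p, (Walk.cons_isPath_iff _ _).2 hp⟩
      have h2 : q = Walk.cons hab p := congrArg Subtype.val this
      rw [h2]; simp

lemma exit_none {G T : SimpleGraph V} (hT : IsT G T) {x z : V} (h : T.Adj x z) :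
    ¬ (D T x z).Reachable z x := fun h' => D_not_reach hT.2.2 h h'.symm

lemma forward {G F : SimpleGraph V} {x y u z : V} (huz : G.Adj u z) (hF : IsF G x y F)
    (hz : F.Reachable z x) (hu : F.Reachable u y) :
    ¬ F.Reachable u z ∧ IsT G (F ⊔ edge u z) := by
  have hn : ¬ F.Reachable u z := fun h => hF.2.2.1 ((hz.symm.trans h.symm).trans hu)
  refine ⟨hn, ?_, ?_, hF.2.1.sup_edge_of_not_reachable hn⟩
  · refine sup_le hF.1 ?_
    intro a b hab
    rw [edge_adj] at hab
    rcases hab with ⟨⟨rfl, rfl⟩ | ⟨rfl, rfl⟩, _⟩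
    · exact huz
    · exact huz.symm
  · have hle : F ≤ F ⊔ edge u z := le_sup_left
    have he : (F ⊔ edge u z).Reachable z u := by
      refine Adj.reachable ?_
      rw [sup_adj, edge_adj]
      exact Or.inr ⟨Or.inr ⟨rfl, rfl⟩, huz.ne.symm⟩
    have hall : ∀ w, (F ⊔ edge u z).Reachable w u := by
      intro w
      rcases hF.2.2.2 w with h | h
      · exact ((h.trans hz.symm).mono hle).trans he
      · exact (h.trans hu.symm).mono hle
    have : Nonempty V := ⟨u⟩
    exact ⟨fun a b => (hall a).trans (hall b).symm⟩

lemma backward {G T : SimpleGraph V} {x y u z : V} (hT : IsT G T) (huz : T.Adj u z)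
    (hz : (D T u z).Reachable z x) (hu : (D T u z).Reachable u y) : IsF G x y (D T u z) := by
  refine ⟨(D_le _ _ _).trans hT.1, hT.2.2.anti (D_le _ _ _), fun h => ?_, fun w => ?_⟩
  · exact D_not_reach hT.2.2 huz ((hu.trans h.symm).trans hz.symm)
  · exact (hT.side u z w).symm.imp (fun h => h.trans hz) (fun h => h.trans hu)

variable [Fintype V]
open Classical in
lemma card_pairs {G : SimpleGraph V} {x y u z : V} (huz : G.Adj u z) :
    #{F : SimpleGraph V | IsF G x y F ∧ F.Reachable z x ∧ F.Reachable u y} =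
    #{T : SimpleGraph V | IsT G T ∧ T.Adj u z ∧ (D T u z).Reachable z x ∧
      (D T u z).Reachable u y} := by
  refine Finset.card_bij' (fun F _ => F ⊔ edge u z) (fun T _ => D T u z) ?_ ?_ ?_ ?_
  · intro F hF
    simp only [mem_filter, mem_univ, true_and] at hF ⊢
    obtain ⟨h1, h2⟩ := forward huz hF.1 hF.2.1 hF.2.2
    refine ⟨h2, ?_, ?_⟩
    · rw [sup_adj, edge_adj]; exact Or.inr ⟨Or.inl ⟨rfl, rfl⟩, huz.ne⟩
    · rw [D_sup h1]; exact hF.2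
  · intro T hT
    simp only [mem_filter, mem_univ, true_and] at hT ⊢
    exact ⟨backward hT.1 hT.2.1 hT.2.2.1 hT.2.2.2, hT.2.2⟩
  · intro F hF
    simp only [mem_filter, mem_univ, true_and] at hF
    exact D_sup (forward huz hF.1 hF.2.1 hF.2.2).1
  · intro T hT
    simp only [mem_filter, mem_univ, true_and] at hT
    exact sup_D hT.2.1

open Classical in
/-- The potential. -/
noncomputable def phi (G : SimpleGraph V) (x y v : V) : ℝ :=
  ∑ F : SimpleGraph V, if IsF G x y F ∧ F.Reachable v x then 1 else 0

lemma IsF.comm {G F : SimpleGraph V} {x y : V} : IsF G x y F ↔ IsF G y x F := by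
  unfold IsF
  rw [reachable_comm]
  simp only [or_comm]

open Classical in
lemma phi_diff {G : SimpleGraph V} {x y u z : V} (huz : G.Adj u z) :
    phi G x y z - phi G x y u = ∑ T : SimpleGraph V, if IsT G T then
      ((if T.Adj u z ∧ (D T u z).Reachable z x then (1 : ℝ) else 0) -
        (if T.Adj u z ∧ (D T u z).Reachable z y then 1 else 0)) else 0 := by
  have hA := card_pairs (x := x) (y := y) huz
  have hB := card_pairs (x := y) (y := x) huz
  simp only [Finset.card_filter] at hA hB
  have hA' := congrArg (Nat.cast : ℕ → ℝ) hA
  have hB' := congrArg (Nat.cast : ℕ → ℝ) hB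
  push_cast at hA' hB'
  have h1 : phi G x y z - phi G x y u =
      (∑ F : SimpleGraph V,
        if IsF G x y F ∧ F.Reachable z x ∧ F.Reachable u y then (1 : ℝ) else 0) -
      ∑ F : SimpleGraph V,
        if IsF G y x F ∧ F.Reachable z y ∧ F.Reachable u x then (1 : ℝ) else 0 := by
    unfold phi
    rw [← Finset.sum_sub_distrib, ← Finset.sum_sub_distrib]
    refine Finset.sum_congr rfl fun F _ => ?_
    rw [IsF.comm (x := y)]
    by_cases hF : IsF G x y F
    · have hx : ∀ w, F.Reachable w x → ¬ F.Reachable w y :=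
        fun w h h' => hF.2.2.1 (h.symm.trans h')
      have a1 := hx z
      have a2 := hx u
      have b1 := hF.2.2.2 z
      have b2 := hF.2.2.2 u
      by_cases c1 : F.Reachable z x <;> by_cases c2 : F.Reachable u x <;>
        by_cases c3 : F.Reachable z y <;> by_cases c4 : F.Reachable u y <;> simp_all
    · simp [hF]
  rw [h1, hA', hB', ← Finset.sum_sub_distrib]
  refine Finset.sum_congr rfl fun T _ => ?_
  by_cases hT : IsT G T
  · by_cases ha : T.Adj u z
    · have hn := D_not_reach hT.2.2 ha
      have hx : ∀ w, (D T u z).Reachable z w → ¬ (D T u z).Reachable u w :=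
        fun w h h' => hn (h'.trans h.symm)
      have a1 := hx x
      have a2 := hx y
      have b1 := (hT.side u z x).imp Reachable.symm Reachable.symm
      have b2 := (hT.side u z y).imp Reachable.symm Reachable.symm
      by_cases c1 : (D T u z).Reachable z x <;> by_cases c2 : (D T u z).Reachable u x <;>
        by_cases c3 : (D T u z).Reachable z y <;> by_cases c4 : (D T u z).Reachable u y <;>
        simp_all
    · simp [ha]
  · simp [hT]

open Classical in
lemma exit_sum {G T : SimpleGraph V} (hT : IsT G T) (u x : V) :
    (∑ z : V, if T.Adj u z ∧ (D T u z).Reachable z x then (1 : ℝ) else 0) =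
      if u = x then 0 else 1 := by
  by_cases h : u = x
  · subst h
    simp only [if_true]
    refine Finset.sum_eq_zero fun z _ => ?_
    rw [if_neg]
    exact fun h' => exit_none hT h'.1 h'.2
  · rw [if_neg h]
    obtain ⟨z, hz, huniq⟩ := exit_unique hT h
    rw [Finset.sum_eq_single z, if_pos hz]
    · intro b _ hb
      rw [if_neg]
      exact fun h' => hb (huniq b h')
    · simp

open Classical in
/-- The Laplacian. -/
noncomputable def lap (G : SimpleGraph V) (f : V → ℝ) (u : V) : ℝ :=
  ∑ z : V, if G.Adj u z then f u - f z else 0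

lemma lap_symm (G : SimpleGraph V) (f g : V → ℝ) :
    ∑ u, g u * lap G f u = ∑ u, f u * lap G g u := by
  classical
  have h : ∀ f g : V → ℝ, ∑ u, g u * lap G f u =
      (∑ u, ∑ z, if G.Adj u z then g u * f u else 0) -
      ∑ u, ∑ z, if G.Adj u z then g u * f z else 0 := by
    intro f g
    rw [← Finset.sum_sub_distrib]
    refine Finset.sum_congr rfl fun u _ => ?_
    rw [lap, Finset.mul_sum, ← Finset.sum_sub_distrib]
    refine Finset.sum_congr rfl fun z _ => ?_
    split_ifs <;> ring
  rw [h, h]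
  congr 1
  · simp only [mul_comm]
  · rw [Finset.sum_comm]
    refine Finset.sum_congr rfl fun u _ => Finset.sum_congr rfl fun z _ => ?_
    simp only [G.adj_comm, mul_comm]

open Classical in
lemma lap_phi (G : SimpleGraph V) (x y u : V) :
    lap G (phi G x y) u = (#{T : SimpleGraph V | IsT G T} : ℝ) *
      ((if u = x then 1 else 0) - (if u = y then 1 else 0)) := by
  have h1 : lap G (phi G x y) u = - ∑ z : V, ∑ T : SimpleGraph V, if IsT G T then
      ((if T.Adj u z ∧ (D T u z).Reachable z x then (1 : ℝ) else 0) -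
        (if T.Adj u z ∧ (D T u z).Reachable z y then 1 else 0)) else 0 := by
    rw [lap, ← Finset.sum_neg_distrib]
    refine Finset.sum_congr rfl fun z _ => ?_
    by_cases h : G.Adj u z
    · rw [if_pos h, ← phi_diff h]; ring
    · rw [if_neg h, eq_comm, neg_eq_zero]
      refine Finset.sum_eq_zero fun T _ => ?_
      by_cases hT : IsT G T
      · have : ¬ T.Adj u z := fun h' => h (hT.1 h')
        simp [this]
      · simp [hT]
  rw [h1, Finset.sum_comm, Finset.card_filter]
  push_cast
  rw [Finset.sum_mul, ← Finset.sum_neg_distrib]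
  refine Finset.sum_congr rfl fun T _ => ?_
  by_cases hT : IsT G T
  · simp only [hT, if_true]
    rw [Finset.sum_sub_distrib, exit_sum hT, exit_sum hT]
    split_ifs <;> ring
  · simp [hT]

lemma phi_right (G : SimpleGraph V) (x y : V) : phi G x y y = 0 := by
  classical
  refine Finset.sum_eq_zero fun F _ => ?_
  rw [if_neg]
  exact fun h => h.1.2.2.1 h.2.symm

lemma phi_left (G : SimpleGraph V) {x y : V} (hxy : x ≠ y) :
    phi G x y x = contractedTreeCount G {x, y} := by
  classical
  unfold phi contractedTreeCount
  rw [Nat.card_eq_fintype_card, Fintype.card_subtype, Finset.card_filter]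
  push_cast
  refine Finset.sum_congr rfl fun F _ => if_congr ?_ rfl rfl
  have : F.Reachable y x ↔ F.Reachable x y := reachable_comm
  simp [IsF, hxy, hxy.symm, this]

end CTTR

open CTTR

/-- $\kappa(x,y)=\mathrm{vol}(G)\tau(G\'')/\tau(G)$ where $G\'$ is obtained from $G$
by identifying $x$ and $y$. -/
theorem commute_time_tree_ratio {V : Type*} [Fintype V] (G : SimpleGraph V)
    [DecidableRel G.Adj] (hG : G.Connected) (x y : V) (hxy : x ≠ y)
    (H : V → V → ℝ) (hH : IsHittingTime G H) :
    H x y + H y x = (∑ v : V, (G.degree v : ℝ)) *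
      (contractedTreeCount G {x, y} : ℝ) / (spanningTreeCount G : ℝ) := by
  classical
  have hτ : spanningTreeCount G =
      (Finset.univ.filter fun T : SimpleGraph V => IsT G T).card := by
    unfold spanningTreeCount
    rw [Nat.card_eq_fintype_card, Fintype.card_subtype]
    congr 1
    ext T
    rw [Finset.mem_filter, Finset.mem_filter]
    rfl
  have hpos : (spanningTreeCount G : ℝ) ≠ 0 := by
    obtain ⟨T, hle, hT⟩ := hG.exists_isTree_le
    rw [hτ, Nat.cast_ne_zero]
    exact Finset.card_ne_zero_of_mem (a := T)
      (Finset.mem_filter.2 ⟨Finset.mem_univ _, hle, hT.1, hT.2⟩)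
  have : Nontrivial V := ⟨x, y, hxy⟩
  have hlap : ∀ w u, u ≠ w → lap G (fun v => H v w) u = G.degree u := by
    intro w u huw
    have hd : (G.degree u : ℝ) ≠ 0 := by
      have := hG.preconnected.degree_pos_of_nontrivial u
      positivity
    have h := hH.2 u w huw
    have e : lap G (fun v => H v w) u =
        G.degree u * H u w - ∑ z ∈ G.neighborFinset u, H z w := by
      have e1 : lap G (fun v => H v w) u = ∑ z ∈ G.neighborFinset u, (H u w - H z w) := by
        rw [lap, SimpleGraph.neighborFinset_eq_filter, Finset.sum_filter]
        refine Finset.sum_congr rfl fun z _ => ?_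
        by_cases hz : G.Adj u z <;> simp [hz]
      rw [e1, Finset.sum_sub_distrib, Finset.sum_const, SimpleGraph.card_neighborFinset_eq_degree,
        nsmul_eq_mul]
    rw [e]
    field_simp at h
    linarith
  have hone : ∀ f : V → ℝ, ∑ u, lap G f u = 0 := by
    intro f
    have := lap_symm G f (fun _ => 1)
    simpa [lap] using this
  have hlap' : ∀ w u, lap G (fun v => H v w) u =
      G.degree u - if u = w then ∑ v : V, (G.degree v : ℝ) else 0 := by
    intro w u
    by_cases h : u = w
    · subst h
      have h0 := hone (fun v => H v u)
      rw [← Finset.add_sum_erase _ _ (Finset.mem_univ u)] at h0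
      rw [Finset.sum_congr rfl fun v hv => hlap u v (Finset.ne_of_mem_erase hv)] at h0
      have h1 := Finset.add_sum_erase Finset.univ (fun v => (G.degree v : ℝ)) (Finset.mem_univ u)
      simp only [if_true]
      linarith
    · rw [hlap w u h, if_neg h, sub_zero]
  have sy := lap_symm G (phi G x y) (fun v => H v y)
  have sx := lap_symm G (phi G x y) (fun v => H v x)
  simp only [lap_phi, hlap', mul_sub, Finset.sum_sub_distrib, mul_ite, mul_zero, mul_one,
    Finset.sum_ite_eq', Finset.mem_univ, if_true, phi_right, phi_left G hxy, hH.1, ← hτ] at sx sy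
  rw [eq_div_iff hpos]
  linarith
end

section
/- Every vertex-transitive connected graph is reversible: H(x,y) = H(y,x) for all vertices x, y. -/
open Matrix in
theorem vtr_lap {V : Type*} [Fintype V] [DecidableEq V] (G : SimpleGraph V)
    [DecidableRel G.Adj] (d : ℝ) (hd : 0 < d) (hdeg : ∀ v, (G.degree v : ℝ) = d)
    (H : V → V → ℝ) (hH : IsHittingTime G H) (y : V) :
    G.lapMatrix ℝ *ᵥ (fun x => H x y) =
      fun x => d - Fintype.card V * d * (if x = y then 1 else 0) := by
  have h1 : ∀ x, x ≠ y → (G.lapMatrix ℝ *ᵥ (fun x => H x y)) x = d := by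
    intro x hx
    rw [SimpleGraph.lapMatrix_mulVec_apply, hdeg]
    have h := hH.2 x y hx
    rw [hdeg] at h
    rw [h]
    field_simp
    ring
  have hs : ∑ x, (G.lapMatrix ℝ *ᵥ (fun x => H x y)) x = 0 := by
    have h0 := Matrix.dotProduct_mulVec (fun _ : V => (1:ℝ)) (G.lapMatrix ℝ) (fun x => H x y)
    rw [← Matrix.mulVec_transpose, (G.isSymm_lapMatrix (R := ℝ)).eq] at h0
    have h2 : G.lapMatrix ℝ *ᵥ (fun _ => (1:ℝ)) = 0 := G.lapMatrix_mulVec_const_eq_zero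
    rw [h2] at h0
    simpa [dotProduct] using h0
  rw [← Finset.add_sum_erase _ _ (Finset.mem_univ y),
    Finset.sum_congr rfl (fun x hx => h1 x (Finset.ne_of_mem_erase hx))] at hs
  have hc : ((Finset.univ.erase y).card : ℝ) = Fintype.card V - 1 := by
    rw [Finset.card_erase_of_mem (Finset.mem_univ y), Finset.card_univ,
      Nat.cast_sub (Fintype.card_pos_iff.2 ⟨y⟩)]
    simp
  rw [Finset.sum_const, nsmul_eq_mul, hc] at hs
  funext x
  by_cases hx : x = y
  · subst hx
    simp only [if_true]
    linarith
  · simp [h1 x hx, hx]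

open Matrix in
theorem vertexTransitive_reversible {V : Type*} [Fintype V] (G : SimpleGraph V)
    [DecidableRel G.Adj] (hG : G.Connected)
    (htrans : ∀ u v : V, ∃ g : G ≃g G, g u = v)
    (H : V → V → ℝ) (hH : IsHittingTime G H) (x y : V) :
    H x y = H y x := by
  classical
  by_cases hxy : x = y
  · rw [hxy]
  have hdeg : ∀ v, (G.degree v : ℝ) = G.degree x := by
    intro v
    obtain ⟨g, hg⟩ := htrans x v
    rw [← hg, SimpleGraph.Iso.degree_eq]
  have hd : (0:ℝ) < G.degree x := by
    have : Nontrivial V := ⟨x, y, hxy⟩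
    exact_mod_cast hG.preconnected.degree_pos_of_nontrivial x
  generalize (G.degree x : ℝ) = d at hdeg hd
  have hn : (0:ℝ) < Fintype.card V := by
    exact_mod_cast Fintype.card_pos_iff.2 ⟨x⟩
  have hL := vtr_lap G d hd hdeg H hH
  have hS : ∑ z, H z x = ∑ z, H z y := by
    obtain ⟨g, hg⟩ := htrans x y
    have hH' : IsHittingTime G (fun a b => H (g a) (g b)) := by
      refine ⟨fun a => hH.1 _, fun a b hab => ?_⟩
      have h := hH.2 (g a) (g b) (fun h => hab (g.injective h))
      simp only
      rw [h, hdeg, hdeg]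
      congr 2
      symm
      refine Finset.sum_bij (fun z _ => g z) ?_ ?_ ?_ ?_
      · intro z hz
        rw [SimpleGraph.mem_neighborFinset] at hz ⊢
        exact g.map_adj_iff.2 hz
      · intro z _ w _ h
        exact g.injective h
      · intro w hw
        refine ⟨g.symm w, ?_, by simp⟩
        rw [SimpleGraph.mem_neighborFinset] at hw ⊢
        rw [← g.map_adj_iff]
        simpa using hw
      · intros; rfl
    have hL' := vtr_lap G d hd hdeg _ hH' x
    have h0 : G.lapMatrix ℝ *ᵥ ((fun a => H (g a) (g x)) - (fun a => H a x)) = 0 := by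
      rw [Matrix.mulVec_sub, hL', hL x, sub_self]
    rw [SimpleGraph.lapMatrix_mulVec_eq_zero_iff_forall_reachable] at h0
    rw [← Equiv.sum_comp g.toEquiv (fun z => H z y)]
    refine Finset.sum_congr rfl fun z _ => ?_
    have h := h0 z x (hG.preconnected z x)
    simp only [Pi.sub_apply, hH.1, hg] at h
    change H z x = H (g z) y
    linarith
  have h0 := Matrix.dotProduct_mulVec (fun z => H z x) (G.lapMatrix ℝ) (fun z => H z y)
  rw [← Matrix.mulVec_transpose, (G.isSymm_lapMatrix (R := ℝ)).eq, hL, hL] at h0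
  simp only [dotProduct, mul_sub, sub_mul, Finset.sum_sub_distrib, ← Finset.sum_mul,
    ← Finset.mul_sum, mul_ite, ite_mul, mul_one, mul_zero, zero_mul, Finset.sum_ite_eq',
    Finset.mem_univ, if_true, hS] at h0
  have h1 : (Fintype.card V * d) * H x y = (Fintype.card V * d) * H y x := by linarith
  exact mul_left_cancel₀ (by positivity) h1
end

section
/- For a vertex-weighted graph (G,w) with integer weights w_v ≥ d_v, R(G,w) equals the number of spanning trees of the completion multigraph obtained by adding a new vertex • and joining • to each vertex v by w_v − d_v parallel edges. -/
/-- `R` realizes the Xu–Yau invariant `R(·, w)` on the induced subgraphs of `G`: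
`R ∅ = 1` and for every vertex subset `s` and every `x ∈ s`,
`R s = w x * R (s − x) − Σ_{y ∈ s, y ∼ x} Σ_{P a simple path from x to y inside s} R (s − P)`. -/
def IsRInvariant {V : Type*} [Fintype V] [DecidableEq V] (G : SimpleGraph V)
    [DecidableRel G.Adj] (w : V → ℝ) (R : Finset V → ℝ) : Prop :=
  R ∅ = 1 ∧
  ∀ s : Finset V, ∀ x ∈ s, R s = w x * R (s.erase x) -
    ∑ y ∈ s, if G.Adj x y then
      (∑ P : G.Path x y, if ∀ v ∈ P.1.support, v ∈ s
        then R (s \ P.1.support.toFinset) else 0)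
      else 0

/-- The number of spanning trees of the multigraph on `W` whose edge multiplicities are
given by the symmetric function `mult`: a spanning tree is a spanning tree `T` of the
underlying simple graph together with a symmetric choice of one of the `mult u v`
parallel edges for each edge of `T`. -/
noncomputable def multigraphTreeCount {W : Type*} [Fintype W] (mult : W → W → ℕ) : ℕ :=
  Nat.card {Tf : SimpleGraph W × (W → W → ℕ) //
    Tf.1.Connected ∧ Tf.1.IsAcyclic ∧
    (∀ u v, Tf.1.Adj u v → Tf.2 u v < mult u v) ∧
    (∀ u v, Tf.2 u v = Tf.2 v u) ∧
    (∀ u v, ¬Tf.1.Adj u v → Tf.2 u v = 0)}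

/-- Edge multiplicities of the completion multigraph `G̅` of `(G, w)`: the vertex `none`
is the added vertex `•`, joined to each `v` by `w v − d v` parallel edges. -/
def completionMult {V : Type*} [Fintype V] (G : SimpleGraph V) [DecidableRel G.Adj]
    (w : V → ℤ) : Option V → Option V → ℕ :=
  fun a b =>
    match a, b with
    | some u, some v => if G.Adj u v then 1 else 0
    | some v, none => (w v - G.degree v).toNat
    | none, some v => (w v - G.degree v).toNat
    | none, none => 0

open Classical in
/-- The parent function `p` has no cycle. -/
def Acyc {V : Type*} (p : V → Option V) : Prop := WellFounded (fun u v => p v = some u)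

/-- the walk follows the parent function -/
def Follows {V : Type*} {G : SimpleGraph V} (p : V → Option V) :
    ∀ {a b : V}, G.Walk a b → Prop
  | _, _, .nil => True
  | a, _, .cons (v := v) _ P => p a = some v ∧ Follows p P

section follows
variable {V : Type*} {G : SimpleGraph V}

theorem Acyc.trim {p q : V → Option V} (hp : Acyc p) (h : ∀ v, q v = p v ∨ q v = none) :
    Acyc q := by
  refine Subrelation.wf (r := fun u v => p v = some u) ?_ hp
  intro u v huv
  rcases h v with h | h
  · rw [← h]; exact huv
  · simp [h] at huv

theorem Follows.reach {p : V → Option V} {a b : V} (P : G.Walk a b) (h : Follows p P) :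
    ∀ c ∈ P.support, Relation.ReflTransGen (fun v u => p v = some u) a c := by
  induction P with
  | nil => intro c hc; simp at hc; subst hc; exact .refl
  | cons hadj P ih =>
    intro c hc
    rw [SimpleGraph.Walk.support_cons, List.mem_cons] at hc
    rcases hc with rfl | hc
    · exact .refl
    · exact .head h.1 (ih h.2 c hc)

theorem Acyc.no_cycle {p : V → Option V} (hp : Acyc p) {a b : V}
    (h : Relation.ReflTransGen (fun v u => p v = some u) a b) (hb : p b = some a) : False := by
  have h1 : Relation.TransGen (fun v u => p v = some u) a a := .tail' h hb
  have h2 := (WellFounded.transGen hp)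
  have h3 : Relation.TransGen (fun u v => p v = some u) a a := by
    rw [← Relation.transGen_swap] at h1
    exact h1
  exact h2.irrefl.irrefl _ h3

theorem Follows.congr {p q : V → Option V} {a b : V} (P : G.Walk a b) (h : Follows p P)
    (hpq : ∀ v ∈ P.support, q v = p v) : Follows q P := by
  induction P with
  | nil => trivial
  | cons hadj P ih =>
    refine ⟨?_, ih h.2 fun v hv => hpq v (by simp [hv])⟩
    rw [hpq _ (by simp)]; exact h.1

theorem Follows.unique {p : V → Option V} {x a b c : V} (P : G.Walk a b) (Q : G.Walk a c)
    (hP : Follows p P) (hQ : Follows p Q) (hb : p b = some x) (hc : p c = some x)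
    (hxP : x ∉ P.support.tail) (hxQ : x ∉ Q.support.tail) :
    (⟨b, P⟩ : Σ y, G.Walk a y) = ⟨c, Q⟩ := by
  induction P with
  | nil =>
    cases Q with
    | nil => rfl
    | cons h Q =>
      have := hQ.1
      rw [hb] at this
      cases this
      simp at hxQ
  | cons h P ih =>
    cases Q with
    | nil =>
      have := hP.1
      rw [hc] at this
      cases this
      simp at hxP
    | cons h' Q =>
      have h1 := hP.1
      have h2 := hQ.1
      rw [h1] at h2
      cases h2
      have := ih Q hP.2 hQ.2 hb (fun h => hxP (by simpa using List.mem_of_mem_tail h))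
        (fun h => hxQ (by simpa using List.mem_of_mem_tail h))
      cases this
      rfl

theorem Follows.ext {p q : V → Option V} {a b : V} (P : G.Walk a b) (hp : Follows p P)
    (hq : Follows q P) (hb : p b = q b) : ∀ v ∈ P.support, p v = q v := by
  induction P with
  | nil => intro v hv; simp at hv; subst hv; exact hb
  | cons h P ih =>
    intro v hv
    rw [SimpleGraph.Walk.support_cons, List.mem_cons] at hv
    rcases hv with rfl | hv
    · rw [hp.1, hq.1]
    · exact ih hp.2 hq.2 hb v hv

open Classical in
theorem Follows.exists {a b : V} (P : G.Walk a b) (hP : P.IsPath) (q : V → Option V)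
    (t : Option V) : ∃ p : V → Option V, Follows p P ∧ p b = t ∧ ∀ v ∉ P.support, p v = q v := by
  induction P with
  | nil =>
    refine ⟨Function.update q _ t, trivial, Function.update_self .., ?_⟩
    intro v hv
    simp at hv
    simp [hv]
  | @cons u v w h P ih =>
    rw [SimpleGraph.Walk.cons_isPath_iff] at hP
    obtain ⟨p, h1, h2, h3⟩ := ih hP.1
    refine ⟨Function.update p u (some v), ⟨by simp, ?_⟩, ?_, ?_⟩
    · refine h1.congr P fun z hz => ?_
      rw [Function.update_of_ne]
      rintro rfl; exact hP.2 hz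
    · rw [Function.update_of_ne, h2]
      rintro rfl; exact hP.2 P.end_mem_support
    · intro z hz
      simp only [SimpleGraph.Walk.support_cons, List.mem_cons, not_or] at hz
      rw [Function.update_of_ne hz.1, h3 z hz.2]

theorem Follows.acc {p q : V → Option V} {a b : V} (P : G.Walk a b) (hp : Follows p P)
    (hq : ∀ v, q v = p v ∨ q v = none) (hb : Acc (fun u v => q v = some u) b) :
    ∀ v ∈ P.support, Acc (fun u v => q v = some u) v := by
  induction P with
  | nil => intro v hv; simp at hv; subst hv; exact hb
  | cons h P ih =>
    intro v hv
    rw [SimpleGraph.Walk.support_cons, List.mem_cons] at hv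
    rcases hv with rfl | hv
    · constructor
      intro z hz
      rcases hq v with h' | h'
      · rw [h', hp.1] at hz
        cases hz
        exact ih hp.2 hb _ (by simp)
      · simp [h'] at hz
    · exact ih hp.2 hb v hv

theorem Follows.prop {p : V → Option V} {a b : V} (P : G.Walk a b) (hp : Follows p P)
    (hb : ∃ t, p b = some t) : ∀ v ∈ P.support, ∃ t, p v = some t := by
  induction P with
  | nil => intro v hv; simp at hv; subst hv; exact hb
  | cons h P ih =>
    intro v hv
    rw [SimpleGraph.Walk.support_cons, List.mem_cons] at hv
    rcases hv with rfl | hv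
    · exact ⟨_, hp.1⟩
    · exact ih hp.2 hb v hv

theorem Follows.adj {p : V → Option V} {a b : V} (P : G.Walk a b) (hp : Follows p P)
    (hb : ∀ t, p b = some t → G.Adj b t) : ∀ v ∈ P.support, ∀ t, p v = some t → G.Adj v t := by
  induction P with
  | nil => intro v hv; simp at hv; subst hv; exact hb
  | cons h P ih =>
    intro v hv
    rw [SimpleGraph.Walk.support_cons, List.mem_cons] at hv
    rcases hv with rfl | hv
    · intro t ht
      rw [hp.1] at ht; cases ht; exact h
    · exact ih hp.2 hb v hv

theorem exists_cycle [DecidableEq V] {p : V → Option V} {x : V} (hadj : ∀ v u, p v = some u → G.Adj v u)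
    (h1 : Acyc (Function.update p x none)) (h2 : ¬ Acyc p) :
    ∃ y, ∃ P : G.Walk x y, P.IsPath ∧ Follows p P ∧ p y = some x := by
  have upd : ∀ v, v ≠ x → Function.update p x none v = p v := fun v hv => by
    rw [Function.update_of_ne hv]
  have key : ∀ v, v ≠ x → Acc (fun u v => p v = some u) v ∨
      ∃ y, ∃ P : G.Walk v y, P.IsPath ∧ Follows p P ∧ p y = some x ∧ x ∉ P.support := by
    intro v
    induction v using h1.induction with
    | _ v ih =>
    intro hv
    rcases hpv : p v with _ | u
    · left; constructor; intro u hu; simp [hpv] at hu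
    · by_cases hu : u = x
      · subst hu
        right
        exact ⟨v, .nil, by simp, trivial, hpv, by simpa using hv.symm⟩
      · rcases ih u (by rw [upd v hv, hpv]) hu with hacc | ⟨y, P, hP, hF, hy, hx⟩
        · left; constructor; intro z hz; rw [hpv] at hz; cases hz; exact hacc
        · right
          refine ⟨y, .cons (hadj v u hpv) P, ?_, ⟨hpv, hF⟩, hy, ?_⟩
          · rw [SimpleGraph.Walk.cons_isPath_iff]
            refine ⟨hP, fun hmem => ?_⟩
            have hF' : Follows (Function.update p x none) P := hF.congr P fun z hz => by
              apply upd; rintro rfl; exact hx hz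
            exact h1.no_cycle (hF'.reach P v hmem) (by rw [upd v hv, hpv])
          · simp [hx, hv.symm]
  have hx : ¬ Acc (fun u v => p v = some u) x := by
    intro hx
    apply h2
    constructor
    intro v
    induction v using h1.induction with
    | _ v ih =>
    by_cases hv : v = x
    · rw [hv]; exact hx
    · constructor
      intro u hu
      exact ih u (by rw [upd v hv, hu])
  rcases hpx : p x with _ | u
  · exact absurd ⟨_, fun u hu => by simp [hpx] at hu⟩ hx
  · have hux : u ≠ x := by rintro rfl; exact (hadj _ _ hpx).ne rfl
    rcases key u hux with hacc | ⟨y, P, hP, hF, hy, hxP⟩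
    · exact absurd ⟨_, fun z hz => by rw [hpx] at hz; cases hz; exact hacc⟩ hx
    · refine ⟨y, .cons (hadj x u hpx) P, ?_, ⟨hpx, hF⟩, hy⟩
      rw [SimpleGraph.Walk.cons_isPath_iff]
      exact ⟨hP, hxP⟩
end follows

section recursion
variable {V : Type*} [Fintype V] [DecidableEq V] (G : SimpleGraph V) [DecidableRel G.Adj]

/-- arc weights -/
noncomputable def arcW (w : V → ℝ) (v : V) : Option V → ℝ
  | none => w v - G.degree v
  | some u => if G.Adj v u then 1 else 0

open Classical in
/-- weighted count of acyclic parent functions supported on `s` -/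
noncomputable def forestSum (w : V → ℝ) (s : Finset V) : ℝ :=
  ∑ p : V → Option V with ((∀ v, v ∉ s → p v = none) ∧ Acyc p), ∏ v ∈ s, arcW G w v (p v)

theorem arcW_sum (w : V → ℝ) (x : V) : ∑ a, arcW G w x a = w x := by
  rw [Fintype.sum_option]
  simp only [arcW]
  rw [Finset.sum_boole]
  simp [SimpleGraph.degree, SimpleGraph.neighborFinset_eq_filter]

open Classical in
theorem forestSum_erase (w : V → ℝ) (s : Finset V) (x : V) (hx : x ∈ s) :
    w x * forestSum G w (s.erase x) =
    ∑ p : V → Option V with ((∀ v, v ∉ s → p v = none) ∧ Acyc (Function.update p x none)),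
      ∏ v ∈ s, arcW G w v (p v) := by
  rw [← arcW_sum G w x, forestSum, Finset.sum_mul_sum, ← Finset.sum_product']
  refine Finset.sum_nbij' (fun z => Function.update z.2 x z.1)
    (fun p => (p x, Function.update p x none)) ?_ ?_ ?_ ?_ ?_
  · rintro ⟨a, q⟩ h
    simp only [Finset.mem_product, Finset.mem_univ, Finset.mem_filter, true_and,
      Finset.mem_erase] at h ⊢
    obtain ⟨h1, h2⟩ := h
    refine ⟨fun v hv => ?_, ?_⟩
    · rw [Function.update_of_ne (by rintro rfl; exact hv hx)]
      exact h1 v (fun h => hv h.2)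
    · apply h2.trim
      intro v
      by_cases hv : v = x <;> simp [hv]
  · intro p h
    simp only [Finset.mem_product, Finset.mem_univ, Finset.mem_filter, true_and,
      Finset.mem_erase] at h ⊢
    refine ⟨fun v hv => ?_, h.2⟩
    by_cases hvx : v = x
    · simp [hvx]
    · rw [Function.update_of_ne hvx]
      exact h.1 v (fun h => hv ⟨hvx, h⟩)
  · rintro ⟨a, q⟩ h
    simp only [Finset.mem_product, Finset.mem_univ, Finset.mem_filter, true_and,
      Finset.mem_erase] at h
    have := h.1 x (by simp)
    simp [← this]
  · intro p h
    simp
  · rintro ⟨a, q⟩ h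
    rw [← Finset.mul_prod_erase s _ hx]
    simp only [Function.update_self]
    congr 1
    refine Finset.prod_congr rfl fun v hv => ?_
    rw [Function.update_of_ne (Finset.ne_of_mem_erase hv)]

open Classical in
/-- the contribution of a fixed cycle -/
theorem forestSum_cycle (w : V → ℝ) (s : Finset V) (x y : V) (hyx : G.Adj y x)
    (P : G.Walk x y) (hP : P.IsPath) (hs : ∀ v ∈ P.support, v ∈ s) :
    (∑ p : V → Option V with ((∀ v, v ∉ s → p v = none) ∧ Acyc (Function.update p x none) ∧
      Follows p P ∧ p y = some x), ∏ v ∈ s, arcW G w v (p v)) =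
    forestSum G w (s \ P.support.toFinset) := by
  rw [forestSum]
  refine Finset.sum_bij (fun p _ => fun v => if v ∈ P.support then none else p v) ?_ ?_ ?_ ?_
  · intro p h
    simp only [Finset.mem_univ, Finset.mem_filter, true_and, Finset.mem_sdiff,
      List.mem_toFinset] at h ⊢
    obtain ⟨h1, h2, h3, h4⟩ := h
    refine ⟨fun v hv => ?_, h2.trim fun v => ?_⟩
    · split_ifs with hv'
      · rfl
      · exact h1 v (fun h => hv ⟨h, hv'⟩)
    · split_ifs with hv'
      · right; rfl
      · left
        rw [Function.update_of_ne]
        rintro rfl; exact hv' P.start_mem_support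
  · intro p hp q hq hpq
    simp only [Finset.mem_univ, Finset.mem_filter, true_and] at hp hq
    funext v
    by_cases hv : v ∈ P.support
    · exact Follows.ext P hp.2.2.1 hq.2.2.1 (by rw [hp.2.2.2, hq.2.2.2]) v hv
    · have := congrFun hpq v
      simpa [hv] using this
  · intro q hq
    simp only [Finset.mem_univ, Finset.mem_filter, true_and, Finset.mem_sdiff,
      List.mem_toFinset] at hq
    obtain ⟨hq1, hq2⟩ := hq
    obtain ⟨p, h1, h2, h3⟩ := Follows.exists P hP q (some x)
    refine ⟨p, ?_, ?_⟩
    · simp only [Finset.mem_univ, Finset.mem_filter, true_and]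
      refine ⟨fun v hv => ?_, ?_, h1, h2⟩
      · rw [h3 v (fun h => hv (hs v h))]
        exact hq1 v (fun h => hv h.1)
      · have hx : Acc (fun u v => Function.update p x none v = some u) x :=
          ⟨_, fun z hz => by simp at hz⟩
        have hy : Acc (fun u v => Function.update p x none v = some u) y := by
          refine ⟨_, fun z hz => ?_⟩
          rw [Function.update_of_ne hyx.ne, h2] at hz
          cases hz; exact hx
        have hsup := Follows.acc (q := Function.update p x none) P h1 (fun v => by
          by_cases hv : v = x <;> simp [hv]) hy
        constructor
        intro v
        induction v using hq2.induction with
        | _ v ih =>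
        by_cases hv : v ∈ P.support
        · exact hsup v hv
        · refine ⟨_, fun u hu => ih u ?_⟩
          rw [Function.update_of_ne (by rintro rfl; exact hv P.start_mem_support), h3 v hv] at hu
          exact hu
    · funext v
      split_ifs with hv
      · exact (hq1 v (fun h => h.2 hv)).symm
      · exact h3 v hv
  · intro p hp
    simp only [Finset.mem_univ, Finset.mem_filter, true_and] at hp
    rw [← Finset.prod_sdiff (s₁ := P.support.toFinset) (s₂ := s)
      (fun v hv => hs v (by simpa using hv))]
    rw [Finset.prod_eq_one (s := P.support.toFinset), mul_one]
    · refine Finset.prod_congr rfl fun v hv => ?_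
      simp only [Finset.mem_sdiff, List.mem_toFinset] at hv
      simp [hv.2]
    · intro v hv
      rw [List.mem_toFinset] at hv
      obtain ⟨t, ht⟩ := Follows.prop P hp.2.2.1 ⟨x, hp.2.2.2⟩ v hv
      have := Follows.adj P hp.2.2.1 (fun t ht => by
        rw [hp.2.2.2] at ht; cases ht; exact hyx) v hv t ht
      simp [ht, arcW, this]

open Classical in
theorem forestSum_rec (w : V → ℝ) (s : Finset V) (x : V) (hx : x ∈ s) :
    forestSum G w s = w x * forestSum G w (s.erase x) -
    ∑ y ∈ s, if G.Adj x y then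
      (∑ P : G.Path x y, if ∀ v ∈ P.1.support, v ∈ s
        then forestSum G w (s \ P.1.support.toFinset) else 0)
      else 0 := by
  rw [forestSum_erase G w s x hx, eq_sub_iff_add_eq]
  have e1 : (∑ y ∈ s, if G.Adj x y then
      (∑ P : G.Path x y, if ∀ v ∈ P.1.support, v ∈ s
        then forestSum G w (s \ P.1.support.toFinset) else 0)
      else 0) = ∑ z : (Σ y, G.Path x y),
        ∑ p : V → Option V with ((∀ v, v ∉ s → p v = none) ∧ Acyc (Function.update p x none)),
          if G.Adj x z.1 ∧ (∀ v ∈ z.2.1.support, v ∈ s) ∧ Follows p z.2.1 ∧ p z.1 = some x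
          then ∏ v ∈ s, arcW G w v (p v) else 0 := by
    rw [Fintype.sum_sigma]
    have : ∀ F : V → ℝ, (∀ y, y ∉ s → F y = 0) → ∑ y ∈ s, F y = ∑ y, F y := fun F hF =>
      Finset.sum_subset (Finset.subset_univ _) (fun y _ hy => hF y hy)
    rw [this]
    · refine Finset.sum_congr rfl fun y _ => ?_
      split_ifs with hxy
      · refine Finset.sum_congr rfl fun P _ => ?_
        split_ifs with hs
        · rw [← forestSum_cycle G w s x y hxy.symm P.1 P.2 hs, ← Finset.sum_filter,
            Finset.filter_filter]
          refine Finset.sum_congr ?_ fun _ _ => rfl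
          ext p
          simp only [Finset.mem_filter, Finset.mem_univ, true_and]
          tauto
        · simp [hs]
      · simp [hxy]
    · intro y hy
      split_ifs
      · refine Finset.sum_eq_zero fun P _ => ?_
        rw [if_neg]
        intro h
        exact hy (h y P.1.end_mem_support)
      · rfl
  rw [e1, Finset.sum_comm, forestSum, Finset.sum_filter, Finset.sum_filter, Finset.sum_filter,
    ← Finset.sum_add_distrib]
  refine Finset.sum_congr rfl fun p _ => ?_
  by_cases h0 : ∀ v, v ∉ s → p v = none
  swap
  · simp [h0]
  by_cases hA : Acyc p
  · have hA' : Acyc (Function.update p x none) := hA.trim fun v => by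
      by_cases hv : v = x <;> simp [hv]
    rw [if_pos ⟨h0, hA⟩, if_pos ⟨h0, hA'⟩, if_pos ⟨h0, hA'⟩, Finset.sum_eq_zero, add_zero]
    rintro ⟨y, P⟩ _
    rw [if_neg]
    rintro ⟨-, -, h3, h4⟩
    exact hA.no_cycle (h3.reach P.1 y P.1.end_mem_support) h4
  · rw [if_neg (fun h => hA h.2), zero_add]
    by_cases hA' : Acyc (Function.update p x none)
    swap
    · simp [hA']
    rw [if_pos ⟨h0, hA'⟩, if_pos ⟨h0, hA'⟩]
    by_cases hadj : ∀ v u, p v = some u → G.Adj v u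
    · obtain ⟨y, P, hP, hF, hy⟩ := exists_cycle hadj hA' hA
      rw [Fintype.sum_eq_single (⟨y, ⟨P, hP⟩⟩ : Σ y, G.Path x y)]
      · rw [if_pos]
        refine ⟨(hadj y x hy).symm, fun v hv => ?_, hF, hy⟩
        obtain ⟨t, ht⟩ := hF.prop P ⟨x, hy⟩ v hv
        by_contra hvs
        simp [h0 v hvs] at ht
      · rintro ⟨y', P'⟩ hne
        rw [if_neg]
        rintro ⟨-, -, h3, h4⟩
        apply hne
        have nt : ∀ {z} (Q : G.Walk x z), Q.IsPath → x ∉ Q.support.tail := by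
          intro z Q hQ
          have := hQ.support_nodup
          rw [SimpleGraph.Walk.support_eq_cons] at this
          exact (List.nodup_cons.1 this).1
        have := Follows.unique P'.1 P h3 hF h4 hy (nt _ P'.2) (nt _ hP)
        obtain ⟨P', hP'⟩ := P'
        cases this
        rfl
    · push Not at hadj
      obtain ⟨v, u, hvu, hna⟩ := hadj
      have : ∏ v ∈ s, arcW G w v (p v) = 0 := by
        apply Finset.prod_eq_zero (i := v)
        · by_contra hvs
          simp [h0 v hvs] at hvu
        · simp [hvu, arcW, hna]
      simp [this]

theorem R_eq_forestSum (w : V → ℝ) (R : Finset V → ℝ) (hR : IsRInvariant G w R)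
    (s : Finset V) : R s = forestSum G w s := by
  induction s using Finset.strongInduction with
  | H s ih =>
  rcases s.eq_empty_or_nonempty with rfl | ⟨x, hx⟩
  · rw [hR.1, forestSum]
    rw [Finset.sum_eq_single (fun _ => none)]
    · simp
    · intro p hp hne
      simp only [Finset.mem_filter, Finset.mem_univ, true_and, Finset.notMem_empty,
        not_false_eq_true, forall_true_left] at hp
      exact absurd (funext hp.1) hne
    · intro h
      exfalso
      apply h
      simp only [Finset.mem_filter, Finset.mem_univ, true_and]
      exact ⟨fun _ _ => trivial, ⟨fun v => ⟨_, fun u hu => by simp at hu⟩⟩⟩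
  · rw [hR.2 s x hx, forestSum_rec G w s x hx, ih _ (Finset.erase_ssubset hx)]
    congr 1
    refine Finset.sum_congr rfl fun y _ => ?_
    split_ifs
    · refine Finset.sum_congr rfl fun P _ => ?_
      split_ifs with h
      · apply ih
        refine Finset.ssubset_iff_subset_ne.2 ⟨Finset.sdiff_subset, fun he => ?_⟩
        have : x ∈ s \ P.1.support.toFinset := by rw [he]; exact hx
        simp at this
      · rfl
    · rfl
end recursion

section trees
variable {V : Type*}

/-- the graph on `Option V` of a parent function -/
def parGraph (p : V → Option V) : SimpleGraph (Option V) :=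
  SimpleGraph.fromRel (fun a b => ∃ v, a = some v ∧ p v = b)

theorem Acyc.ne {p : V → Option V} (hp : Acyc p) (v : V) : p v ≠ some v :=
  fun h => hp.no_cycle .refl h

theorem Acyc.ne2 {p : V → Option V} (hp : Acyc p) {v u : V} (h : p v = some u) :
    p u ≠ some v :=
  fun h' => hp.no_cycle (.single h) h'

theorem parGraph_adj {p : V → Option V} (hp : Acyc p) (a b : Option V) :
    (parGraph p).Adj a b ↔ (∃ v, a = some v ∧ p v = b) ∨ (∃ v, b = some v ∧ p v = a) := by
  rw [parGraph, SimpleGraph.fromRel_adj]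
  constructor
  · exact fun h => h.2
  · intro h
    refine ⟨?_, h⟩
    rintro rfl
    rcases h with ⟨v, rfl, h⟩ | ⟨v, rfl, h⟩ <;> exact hp.ne v h

theorem parGraph_adj' {p : V → Option V} (hp : Acyc p) (v : V) :
    (parGraph p).Adj (some v) (p v) := by
  rw [parGraph_adj hp]; exact Or.inl ⟨v, rfl, rfl⟩

theorem parGraph_connected {p : V → Option V} (hp : Acyc p) : (parGraph p).Connected := by
  have h : ∀ a, (parGraph p).Reachable a none := by
    rintro (_ | v)
    · exact .refl _
    · induction v using hp.induction with
      | _ v ih =>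
      have h1 := (parGraph_adj' hp v).reachable
      rcases hv : p v with _ | u
      · rwa [hv] at h1
      · rw [hv] at h1
        exact h1.trans (ih u hv)
  haveI : Nonempty (Option V) := ⟨none⟩
  exact ⟨fun a b => (h a).trans (h b).symm⟩

theorem parGraph_isTree [Fintype V] {p : V → Option V} (hp : Acyc p) : (parGraph p).IsTree := by
  classical
  rw [SimpleGraph.isTree_iff_connected_and_card]
  refine ⟨parGraph_connected hp, le_antisymm ?_
    (parGraph_connected hp).card_vert_le_card_edgeSet_add_one⟩
  have : Nat.card (parGraph p).edgeSet ≤ Nat.card V := by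
    refine Nat.card_le_card_of_surjective
      (fun v => ⟨s(some v, p v), parGraph_adj' hp v⟩) ?_
    rintro ⟨e, he⟩
    induction e using Sym2.ind with
    | _ a b =>
    rw [SimpleGraph.mem_edgeSet, parGraph_adj hp] at he
    rcases he with ⟨v, rfl, h⟩ | ⟨v, rfl, h⟩
    · exact ⟨v, by simp [h]⟩
    · exact ⟨v, by simp [h, Sym2.eq_swap]⟩
  simpa using this

theorem parGraph_inj {p q : V → Option V} (hp : Acyc p) (hq : Acyc q)
    (h : parGraph p = parGraph q) : p = q := by
  funext v
  induction v using hp.induction with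
  | _ v ih =>
  have h1 := parGraph_adj' hp v
  rw [h, parGraph_adj hq] at h1
  rcases h1 with ⟨u, hu, h1⟩ | ⟨u, hu, h1⟩
  · cases hu; exact h1.symm
  · have := ih u hu
    rw [← this] at h1
    exact absurd h1 (hp.ne2 hu)

theorem parGraph_surj (T : SimpleGraph (Option V)) (hT : T.IsTree) :
    ∃ p, Acyc p ∧ parGraph p = T := by
  have h : ∀ v : V, ∃ b, T.Adj (some v) b ∧ T.dist b none < T.dist (some v) none := by
    intro v
    obtain ⟨W, hW⟩ := hT.1.exists_walk_length_eq_dist (some v) none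
    cases W with
    | cons h W =>
      refine ⟨_, h, ?_⟩
      have := SimpleGraph.dist_le W
      rw [← hW, SimpleGraph.Walk.length_cons]
      omega
  choose p h1 h2 using h
  have hp : Acyc p := by
    refine Subrelation.wf (r := fun u v => T.dist (some u) none < T.dist (some v) none) ?_
      (InvImage.wf (fun v => T.dist (some v) none) Nat.lt_wfRel.wf)
    intro u v huv
    have := h2 v
    rwa [huv] at this
  refine ⟨p, hp, ?_⟩
  have hle : parGraph p ≤ T := by
    intro a b hab
    rw [parGraph_adj hp] at hab
    rcases hab with ⟨v, rfl, rfl⟩ | ⟨v, rfl, rfl⟩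
    · exact h1 v
    · exact (h1 v).symm
  exact le_antisymm hle (((SimpleGraph.isTree_iff_minimal_connected).1 hT).2
    (parGraph_connected hp) hle)

open Classical in
/-- edge labels from vertex labels -/
noncomputable def parLabel (p : V → Option V) (l : V → ℕ) (a b : Option V) : ℕ :=
  if h : ∃ v, a = some v ∧ p v = b then l h.choose
  else if h : ∃ v, b = some v ∧ p v = a then l h.choose else 0

theorem parLabel_fst (p : V → Option V) (l : V → ℕ) (v : V) :
    parLabel p l (some v) (p v) = l v := by
  have h : ∃ u, some v = some u ∧ p u = p v := ⟨v, rfl, rfl⟩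
  rw [parLabel, dif_pos h]
  congr 1
  exact (Option.some.inj h.choose_spec.1).symm

theorem parLabel_snd {p : V → Option V} (hp : Acyc p) (l : V → ℕ) (v : V) :
    parLabel p l (p v) (some v) = l v := by
  have h : ∃ u, some v = some u ∧ p u = p v := ⟨v, rfl, rfl⟩
  have h' : ¬ ∃ u, p v = some u ∧ p u = some v := by
    rintro ⟨u, h1, h2⟩; exact hp.ne2 h1 h2
  rw [parLabel, dif_neg h', dif_pos h]
  congr 1
  exact (Option.some.inj h.choose_spec.1).symm

theorem parLabel_other {p : V → Option V} (hp : Acyc p) (l : V → ℕ) (a b : Option V)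
    (h : ¬ (parGraph p).Adj a b) : parLabel p l a b = 0 := by
  rw [parGraph_adj hp, not_or] at h
  rw [parLabel, dif_neg h.1, dif_neg h.2]

theorem parLabel_symm {p : V → Option V} (hp : Acyc p) (l : V → ℕ) (a b : Option V) :
    parLabel p l a b = parLabel p l b a := by
  by_cases h : (parGraph p).Adj a b
  · rw [parGraph_adj hp] at h
    rcases h with ⟨v, rfl, rfl⟩ | ⟨v, rfl, rfl⟩ <;> rw [parLabel_fst, parLabel_snd hp]
  · rw [parLabel_other hp l a b h, parLabel_other hp l b a (fun h' => h h'.symm)]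

open Classical in
theorem treeCount_eq [Fintype V] (mult : Option V → Option V → ℕ)
    (hm : ∀ a b, mult a b = mult b a) :
    multigraphTreeCount mult =
      ∑ p : V → Option V with Acyc p, ∏ v, mult (some v) (p v) := by
  have hc : Fintype.card (Σ p : {p : V → Option V // Acyc p}, ∀ v, Fin (mult (some v) (p.1 v)))
      = ∑ p : V → Option V with Acyc p, ∏ v, mult (some v) (p v) := by
    rw [Fintype.card_sigma]
    simp only [Fintype.card_pi, Fintype.card_fin]
    rw [Finset.sum_subtype (p := fun p => Acyc p) _ (by simp)]
  rw [← hc, ← Nat.card_eq_fintype_card, multigraphTreeCount]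
  symm
  refine Nat.card_congr (Equiv.ofBijective (fun z => ⟨(parGraph z.1.1,
    parLabel z.1.1 (fun v => (z.2 v : ℕ))), ?_⟩) ⟨?_, ?_⟩)
  · obtain ⟨⟨p, hp⟩, l⟩ := z
    refine ⟨(parGraph_isTree hp).1, (parGraph_isTree hp).2, ?_, parLabel_symm hp (fun v => (l v : ℕ)),
      parLabel_other hp (fun v => (l v : ℕ))⟩
    intro a b h
    dsimp only at h ⊢
    rw [parGraph_adj hp] at h
    rcases h with ⟨v, rfl, rfl⟩ | ⟨v, rfl, rfl⟩
    · rw [parLabel_fst]; exact (l v).2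
    · rw [parLabel_snd hp]; exact (l v).2.trans_eq (hm _ _)
  · rintro ⟨⟨p, hp⟩, l⟩ ⟨⟨q, hq⟩, l'⟩ h
    simp only [Subtype.mk.injEq, Prod.mk.injEq] at h
    obtain ⟨h1, h2⟩ := h
    have := parGraph_inj hp hq h1
    subst this
    congr 1
    funext v
    have := congrFun (congrFun h2 (some v)) (p v)
    rw [parLabel_fst, parLabel_fst] at this
    exact Fin.ext this
  · rintro ⟨⟨T, f⟩, h1, h2, h3, h4, h5⟩
    obtain ⟨p, hp, rfl⟩ := parGraph_surj T ⟨h1, h2⟩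
    refine ⟨⟨⟨p, hp⟩, fun v => ⟨f (some v) (p v), h3 _ _ (parGraph_adj' hp v)⟩⟩, ?_⟩
    simp only [Subtype.mk.injEq, Prod.mk.injEq, true_and]
    funext a b
    by_cases h : (parGraph p).Adj a b
    · rw [parGraph_adj hp] at h
      rcases h with ⟨v, rfl, rfl⟩ | ⟨v, rfl, rfl⟩
      · rw [parLabel_fst]
      · rw [parLabel_snd hp]; exact h4 _ _
    · rw [parLabel_other hp _ _ _ h]; exact (h5 _ _ h).symm
end trees

/-- `R(G, w) = τ(G̅)`: the invariant `R` equals the number of spanning trees of the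
completion multigraph. -/
theorem R_eq_completion_tree_count {V : Type*} [Fintype V] [DecidableEq V]
    (G : SimpleGraph V) [DecidableRel G.Adj] (w : V → ℤ)
    (hw : ∀ v, (G.degree v : ℤ) ≤ w v)
    (R : Finset V → ℝ) (hR : IsRInvariant G (fun v => (w v : ℝ)) R) :
    R Finset.univ = (multigraphTreeCount (completionMult G w) : ℝ) := by

  classical
  rw [R_eq_forestSum G _ R hR, treeCount_eq, forestSum]
  · push_cast
    refine Finset.sum_congr ?_ fun p _ => Finset.prod_congr rfl fun v _ => ?_
    · ext p; simp
    · rcases p v with _ | u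
      · simp only [arcW, completionMult]
        have h : (((w v - G.degree v).toNat : ℤ) : ℝ) = ((w v - G.degree v : ℤ) : ℝ) := by
          rw [Int.toNat_of_nonneg (sub_nonneg.2 (hw v))]
        push_cast at h
        exact h.symm
      · simp [arcW, completionMult]
  · rintro (_ | a) (_ | b) <;> simp [completionMult, G.adj_comm]
end
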